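/- arXiv:1501.04193 — 2 statements merged into one kernel-verified Lean document; each statement's English description precedes it below -/
import Mathlib

section
/- O¹_4(ℚ) = ℚ[g¹_4, (g¹_4)⁻¹, (g¹_4 − 16)⁻¹], where g¹_4(τ) = g_{1,4}(τ/4) = g_{(1/4,0)}(τ)⁻⁸ g_{(1/2,0)}(τ)⁸. -/
noncomputable section

open Complex Matrix UpperHalfPlane MatrixGroups

abbrev SL2Z := Matrix.SpecialLinearGroup (Fin 2) ℤ

/-- `e2pi z = exp(2πiz)`. -/
def e2pi (z : ℂ) : ℂ := Complex.exp (2 * Real.pi * Complex.I * z)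

/-- `qpow τ x = q^x = exp(2πixτ)`. -/
def qpow (τ : ℍ) (x : ℂ) : ℂ := Complex.exp (2 * Real.pi * Complex.I * x * τ)

/-- The lattice point `mτ + n` for `p = (m, n)`. -/
def latticePt (τ : ℍ) (p : ℤ × ℤ) : ℂ := (p.1 : ℂ) * τ + (p.2 : ℂ)

/-- Weierstrass invariant `g₂` of the lattice `[τ, 1]`. -/
def g2fun (τ : ℍ) : ℂ := 60 * ∑' p : {p : ℤ × ℤ // p ≠ 0}, (latticePt τ p.1)⁻¹ ^ 4

/-- Weierstrass invariant `g₃` of the lattice `[τ, 1]`. -/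
def g3fun (τ : ℍ) : ℂ := 140 * ∑' p : {p : ℤ × ℤ // p ≠ 0}, (latticePt τ p.1)⁻¹ ^ 6

/-- The discriminant `Δ = g₂³ - 27g₃²`. -/
def deltaFun (τ : ℍ) : ℂ := g2fun τ ^ 3 - 27 * g3fun τ ^ 2

/-- The elliptic modular function `j = 1728 g₂³/Δ`. -/
def jfun (τ : ℍ) : ℂ := 1728 * g2fun τ ^ 3 / deltaFun τ

/-- The Weierstrass `℘`-function of the lattice `[τ, 1]`. -/
def wpfun (τ : ℍ) (z : ℂ) : ℂ :=
  z⁻¹ ^ 2 + ∑' p : {p : ℤ × ℤ // p ≠ 0},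
    ((z - latticePt τ p.1)⁻¹ ^ 2 - (latticePt τ p.1)⁻¹ ^ 2)

/-- The Fricke function `f_v = -2⁷3⁵ (g₂g₃/Δ) ℘(v₁τ + v₂)`. -/
def fricke (v : ℚ × ℚ) (τ : ℍ) : ℂ :=
  -(2 ^ 7 * 3 ^ 5 : ℂ) * g2fun τ * g3fun τ / deltaFun τ *
    wpfun τ ((v.1 : ℂ) * τ + (v.2 : ℂ))

/-- The Siegel function `g_v`, via its `q`-product expansion. -/
def siegel (v : ℚ × ℚ) (τ : ℍ) : ℂ :=
  -Complex.exp (Real.pi * Complex.I * (v.2 : ℂ) * ((v.1 : ℂ) - 1)) *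
    qpow τ (((v.1 : ℂ) ^ 2 - (v.1 : ℂ) + 1 / 6) / 2) *
    (1 - qpow τ (v.1 : ℂ) * e2pi (v.2 : ℂ)) *
    ∏' n : ℕ,
      ((1 - qpow τ ((n : ℂ) + 1 + (v.1 : ℂ)) * e2pi (v.2 : ℂ)) *
       (1 - qpow τ ((n : ℂ) + 1 - (v.1 : ℂ)) * e2pi (-(v.2 : ℂ))))

/-- Extend a function on `ℍ` to `ℂ` by junk values. -/
def asComplexFun (h : ℍ → ℂ) : ℂ → ℂ :=
  fun z => if hz : 0 < z.im then h ⟨z, hz⟩ else 0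

/-- `h` is holomorphic on `ℍ`. -/
def IsHoloOnH (h : ℍ → ℂ) : Prop :=
  DifferentiableOn ℂ (asComplexFun h) {z : ℂ | 0 < z.im}

/-- `h` is meromorphic on `ℍ`. -/
def IsMeromOnH (h : ℍ → ℂ) : Prop :=
  MeromorphicOn (asComplexFun h) {z : ℂ | 0 < z.im}

/-- `v ∈ V_N`: `v = (a/N, b/N)` with `gcd(a, b, N) = 1`. -/
def InVN (N : ℕ) (v : ℚ × ℚ) : Prop :=
  ∃ a b : ℤ, v.1 = (a : ℚ) / (N : ℚ) ∧ v.2 = (b : ℚ) / (N : ℚ) ∧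
    Int.gcd a (Int.gcd b (N : ℤ)) = 1

/-- `v ∈ ℤ²`. -/
def IsIntPair (v : ℚ × ℚ) : Prop := ∃ m n : ℤ, v.1 = (m : ℚ) ∧ v.2 = (n : ℚ)

/-- `u ≡ v (mod ℤ²)`. -/
def EqModZ2 (u v : ℚ × ℚ) : Prop := IsIntPair (u.1 - v.1, u.2 - v.2)

/-- `u ≡ ±v (mod ℤ²)`. -/
def PMEquiv (u v : ℚ × ℚ) : Prop := EqModZ2 u v ∨ EqModZ2 u (-v.1, -v.2)

/-- The action `v ↦ ᵗγ·v` of a matrix on a rational pair. -/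
def tAct (γ : Matrix (Fin 2) (Fin 2) ℤ) (v : ℚ × ℚ) : ℚ × ℚ :=
  ((γ 0 0 : ℚ) * v.1 + (γ 1 0 : ℚ) * v.2, (γ 0 1 : ℚ) * v.1 + (γ 1 1 : ℚ) * v.2)

/-- `h` agrees, near `i∞`, with the expansion `∑_{n ≥ n₀} σ_d(c_n) q^{n/N}` where the
coefficients `c_n ∈ ℚ(ζ_N)` are recorded as polynomials in `ζ_N` with rational coefficients
and `σ_d(c_n)` is obtained by evaluating at `ζ_N^d`. -/
def QExp (N : ℕ) (c : ℤ → Polynomial ℚ) (n₀ : ℤ) (d : ℤ) (h : ℍ → ℂ) : Prop :=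
  ∃ A : ℝ, ∀ τ : ℍ, A < τ.im →
    h τ = ∑' n : ℕ, (Polynomial.aeval (e2pi ((d : ℂ) / (N : ℂ))) (c (n₀ + (n : ℤ)))) *
      qpow τ (((n₀ + (n : ℤ) : ℤ) : ℂ) / (N : ℂ))

/-- `h` is meromorphic at `i∞`, with a Fourier expansion in powers of `q^{1/N}`. -/
def CuspExp (N : ℕ) (h : ℍ → ℂ) : Prop :=
  ∃ (n₀ : ℤ) (c : ℤ → ℂ) (A : ℝ), ∀ τ : ℍ, A < τ.im →
    h τ = ∑' n : ℕ, c (n₀ + (n : ℤ)) * qpow τ (((n₀ + (n : ℤ) : ℤ) : ℂ) / (N : ℂ))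

/-- `h` has a Fourier expansion in powers of `q^{1/N}` with rational coefficients. -/
def RatQExp (N : ℕ) (h : ℍ → ℂ) : Prop :=
  ∃ (n₀ : ℤ) (c : ℤ → ℚ) (A : ℝ), ∀ τ : ℍ, A < τ.im →
    h τ = ∑' n : ℕ, (c (n₀ + (n : ℤ)) : ℂ) * qpow τ (((n₀ + (n : ℤ) : ℤ) : ℂ) / (N : ℂ))

/-- `γ ∈ Γ(N)`, i.e. `γ ≡ I₂ (mod N)`. -/
def InGammaN (N : ℕ) (γ : SL2Z) : Prop :=
  ((γ 0 0 : ℤ) : ZMod N) = 1 ∧ ((γ 0 1 : ℤ) : ZMod N) = 0 ∧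
  ((γ 1 0 : ℤ) : ZMod N) = 0 ∧ ((γ 1 1 : ℤ) : ZMod N) = 1

/-- `γ ∈ Γ¹(N)`, i.e. `γ ≡ [[1,0],[*,1]] (mod N)`. -/
def InGamma1Lower (N : ℕ) (γ : SL2Z) : Prop :=
  ((γ 0 0 : ℤ) : ZMod N) = 1 ∧ ((γ 0 1 : ℤ) : ZMod N) = 0 ∧ ((γ 1 1 : ℤ) : ZMod N) = 1

/-- `γ ∈ Γ₁(N)`, i.e. `γ ≡ [[1,*],[0,1]] (mod N)`. -/
def InGamma1Upper (N : ℕ) (γ : SL2Z) : Prop :=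
  ((γ 0 0 : ℤ) : ZMod N) = 1 ∧ ((γ 1 0 : ℤ) : ZMod N) = 0 ∧ ((γ 1 1 : ℤ) : ZMod N) = 1

/-- `h ∈ F_N`: meromorphic on `ℍ`, modular for `Γ(N)`, meromorphic at the cusps and
with Fourier coefficients in `ℚ(ζ_N)`. -/
structure MemFN (N : ℕ) (h : ℍ → ℂ) : Prop where
  merom : IsMeromOnH h
  modular : ∀ γ : SL2Z, InGammaN N γ → ∀ τ : ℍ, h (γ • τ) = h τ
  cusp : ∀ γ : SL2Z, CuspExp N (fun τ => h (γ • τ))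
  coeff : ∃ (c : ℤ → Polynomial ℚ) (n₀ : ℤ), QExp N c n₀ 1 h

/-- `h ∈ F¹_N(ℚ)`: meromorphic on `ℍ`, modular for `Γ¹(N)`, meromorphic at the cusps and
with rational Fourier coefficients. -/
structure MemF1N (N : ℕ) (h : ℍ → ℂ) : Prop where
  merom : IsMeromOnH h
  modular : ∀ γ : SL2Z, InGamma1Lower N γ → ∀ τ : ℍ, h (γ • τ) = h τ
  cusp : ∀ γ : SL2Z, CuspExp N (fun τ => h (γ • τ))
  ratQ : RatQExp N h

/-- `h ∈ O¹_N(ℚ)`: the weakly holomorphic elements of `F¹_N(ℚ)`. -/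
def MemO1N (N : ℕ) (h : ℍ → ℂ) : Prop := MemF1N N h ∧ IsHoloOnH h

/-- `β ∈ SL₂(ℤ)` is a lift of `[[1,0],[0,det γ]]⁻¹ · γ (mod N)`, so that
`γ ≡ [[1,0],[0,det γ]] · β (mod N)`. -/
def SLCompat (N : ℕ) (γ : Matrix (Fin 2) (Fin 2) ℤ) (β : SL2Z) : Prop :=
  ((β 0 0 : ℤ) : ZMod N) = ((γ 0 0 : ℤ) : ZMod N) ∧
  ((β 0 1 : ℤ) : ZMod N) = ((γ 0 1 : ℤ) : ZMod N) ∧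
  ((γ.det : ℤ) : ZMod N) * ((β 1 0 : ℤ) : ZMod N) = ((γ 1 0 : ℤ) : ZMod N) ∧
  ((γ.det : ℤ) : ZMod N) * ((β 1 1 : ℤ) : ZMod N) = ((γ 1 1 : ℤ) : ZMod N)

/-- Condition (F3): for every `γ ∈ GL₂(ℤ/Nℤ)`, written as `[[1,0],[0,d]]·β` with
`d = det γ` and `β ∈ SL₂(ℤ/Nℤ)`, one has `h_v^γ = h_{ᵗγ·v}`; here `h_v^γ = (σ_d h_v) ∘ β`
is expressed through `q`-expansions. -/
def GaloisCompat (N : ℕ) (h : (ℚ × ℚ) → ℍ → ℂ) : Prop :=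
  ∀ v : ℚ × ℚ, InVN N v →
    ∀ γ : Matrix (Fin 2) (Fin 2) ℤ, Int.gcd γ.det (N : ℤ) = 1 →
      ∀ β : SL2Z, SLCompat N γ β →
        ∀ (c : ℤ → Polynomial ℚ) (n₀ : ℤ), QExp N c n₀ 1 (h v) →
          QExp N c n₀ γ.det (fun τ => h (tAct γ v) (β⁻¹ • τ))

/-- A Fricke family of level `N`. -/
structure IsFrickeFamily (N : ℕ) (h : (ℚ × ℚ) → ℍ → ℂ) : Prop where
  mem : ∀ v : ℚ × ℚ, InVN N v → MemFN N (h v)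
  holo : ∀ v : ℚ × ℚ, InVN N v → IsHoloOnH (h v)
  pm : ∀ u v : ℚ × ℚ, InVN N u → InVN N v → PMEquiv u v → h u = h v
  galois : GaloisCompat N h

/-- `ζ₃ = e^{2πi/3}` as a point of `ℍ`. -/
def zeta3H : ℍ := ⟨Complex.exp (2 * Real.pi * Complex.I / 3), by
  have h : (2 * Real.pi * Complex.I / 3 : ℂ) = Complex.I * ((2 * Real.pi / 3 : ℝ) : ℂ) := by
    push_cast; ring
  rw [h]
  rw [show Complex.I * ((2 * Real.pi / 3 : ℝ) : ℂ) = (((2 * Real.pi / 3 : ℝ) : ℂ) * Complex.I) by ring]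
  rw [Complex.exp_ofReal_mul_I_im]
  exact Real.sin_pos_of_pos_of_lt_pi (by positivity) (by nlinarith [Real.pi_pos])⟩

/-- `ζ₄ = i` as a point of `ℍ`. -/
def zeta4H : ℍ := ⟨Complex.I, by simp⟩

/-- The set of points of `ℂ` lying in the `SL₂(ℤ)`-orbit of `ζ₃` or `ζ₄`. -/
def exceptionalSet : Set ℂ :=
  {z : ℂ | ∃ γ : SL2Z, z = ((γ • zeta3H : ℍ) : ℂ) ∨ z = ((γ • zeta4H : ℍ) : ℂ)}

/-- `ℍ' = ℍ ∖ {γζ₃, γζ₄ : γ ∈ SL₂(ℤ)}`, as a subset of `ℂ`. -/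
def upperHalfPlaneSlit : Set ℂ := {z : ℂ | 0 < z.im} \ exceptionalSet

/-- `h` is holomorphic on `ℍ'`. -/
def IsHoloOnH' (h : ℍ → ℂ) : Prop :=
  DifferentiableOn ℂ (asComplexFun h) upperHalfPlaneSlit

/-- Multiplication of a point of `ℍ` by `4`. -/
def fourH (τ : ℍ) : ℍ := ⟨4 * (τ : ℂ), by
  have h : (0:ℝ) < (τ : ℂ).im := τ.2
  have h4 : (4 * (τ : ℂ)).im = 4 * (τ : ℂ).im := by
    simp [Complex.mul_im]
  rw [h4]; linarith⟩


/-- The function `g¹_4(τ) = g_{1,4}(τ/4) = g_{(1/4,0)}(τ)⁻⁸ g_{(1/2,0)}(τ)⁸`. -/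
def g14slash (τ : ℍ) : ℂ := (siegel (1 / 4, 0) τ)⁻¹ ^ 8 * siegel (1 / 2, 0) τ ^ 8

section


open Filter Topology in
/-- partial products `∏_{k<n} (1 - p^{2(k+1)})` -/
def tpD (p : ℂ) (n : ℕ) : ℂ := ∏ k ∈ Finset.range n, (1 - p ^ (2 * (k + 1)))

/-- `1 / tpD`, extended by zero to negative integers -/
def tpDinv (p : ℂ) (m : ℤ) : ℂ := if m < 0 then 0 else (tpD p m.toNat)⁻¹

lemma one_sub_pow_ne {p : ℂ} (hp : ‖p‖ < 1) {k : ℕ} (hk : k ≠ 0) : 1 - p ^ k ≠ 0 := by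
  intro h
  have h1 : p ^ k = 1 := (sub_eq_zero.mp h).symm
  have h2 : ‖p‖ ^ k = 1 := by rw [← norm_pow, h1, norm_one]
  have := pow_lt_one₀ (norm_nonneg p) hp hk
  linarith

lemma one_add_pow_ne {p : ℂ} (hp : ‖p‖ < 1) {k : ℕ} (hk : k ≠ 0) : 1 + p ^ k ≠ 0 := by
  intro h
  have h1 : p ^ k = -1 := by linear_combination h
  have h2 : ‖p‖ ^ k = 1 := by rw [← norm_pow, h1, norm_neg, norm_one]
  have := pow_lt_one₀ (norm_nonneg p) hp hk
  linarith

lemma tpD_ne {p : ℂ} (hp : ‖p‖ < 1) (n : ℕ) : tpD p n ≠ 0 :=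
  Finset.prod_ne_zero_iff.mpr fun k _ => one_sub_pow_ne hp (by omega)

lemma tpDinv_rec {p : ℂ} (hp : ‖p‖ < 1) (m : ℤ) :
    tpDinv p m = (1 - p ^ (2 * (m + 1))) * tpDinv p (m + 1) := by
  unfold tpDinv
  rcases lt_trichotomy m (-1) with h | h | h
  · rw [if_pos (by omega), if_pos (by omega), mul_zero]
  · subst h; simp
  · rw [if_neg (by omega), if_neg (by omega)]
    obtain ⟨k, rfl⟩ := Int.eq_ofNat_of_zero_le (show 0 ≤ m by omega)
    have e1 : ((k : ℤ) + 1).toNat = k + 1 := by omega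
    have e2 : ((k : ℤ)).toNat = k := by omega
    have e3 : p ^ (2 * ((k : ℤ) + 1)) = p ^ (2 * (k + 1)) := by
      rw [← zpow_natCast]; push_cast; rfl
    rw [e1, e2, e3]
    have hs : tpD p (k + 1) = tpD p k * (1 - p ^ (2 * (k + 1))) := by
      simp [tpD, Finset.prod_range_succ]
    rw [hs]
    have h1 := tpD_ne hp k
    have h2 : 1 - p ^ (2 * (k + 1)) ≠ 0 := one_sub_pow_ne hp (by omega)
    field_simp

def tpC (p : ℂ) (n : ℕ) (j : ℤ) : ℂ :=
  p ^ (j ^ 2) * tpD p (2 * n) * tpDinv p (n - j) * tpDinv p (n + j)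

lemma tpC_rec {p : ℂ} (hp : ‖p‖ < 1) (h0 : p ≠ 0) (n : ℕ) (j : ℤ) :
    tpC p (n + 1) j = (1 + p ^ (2 * (2 * n + 1))) * tpC p n j
      + p ^ (2 * n + 1) * (tpC p n (j - 1) + tpC p n (j + 1)) := by
  unfold tpC
  have a1 := tpDinv_rec hp (n - j)
  have a2 := tpDinv_rec hp (n - j - 1)
  have b1 := tpDinv_rec hp (n + j)
  have b2 := tpDinv_rec hp (n + j - 1)
  rw [show (n : ℤ) - j - 1 + 1 = n - j by ring] at a2
  rw [show (n : ℤ) + j - 1 + 1 = n + j by ring] at b2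
  have hD : tpD p (2 * (n + 1)) = tpD p (2 * n) * (1 - p ^ (2 * (2 * n + 1)))
      * (1 - p ^ (2 * (2 * n + 1 + 1))) := by
    rw [show 2 * (n + 1) = 2 * n + 1 + 1 by ring]
    simp [tpD, Finset.prod_range_succ]
  rw [hD]
  push_cast
  rw [show (n : ℤ) + 1 - j = n - j + 1 by ring, show (n : ℤ) + 1 + j = n + j + 1 by ring,
    show (n : ℤ) - (j - 1) = n - j + 1 by ring, show (n : ℤ) + (j - 1) = n + j - 1 by ring,
    show (n : ℤ) - (j + 1) = n - j - 1 by ring, show (n : ℤ) + (j + 1) = n + j + 1 by ring]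
  rw [a2, b2, a1, b1]
  set X := tpDinv p (n - j + 1)
  set Y := tpDinv p (n + j + 1)
  set D := tpD p (2 * n)
  have e1 : p ^ (2 * ((n : ℤ) - j)) = (p ^ n) ^ 2 * ((p ^ j)⁻¹) ^ 2 := by
    rw [← _root_.zpow_neg, ← zpow_natCast p n, ← zpow_natCast _ 2, ← zpow_natCast _ 2, ← _root_.zpow_mul, ← _root_.zpow_mul,
      ← zpow_add₀ h0]
    congr 1; push_cast; ring
  have e2 : p ^ (2 * ((n : ℤ) + j)) = (p ^ n) ^ 2 * (p ^ j) ^ 2 := by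
    rw [← zpow_natCast p n, ← zpow_natCast _ 2, ← zpow_natCast _ 2, ← _root_.zpow_mul, ← _root_.zpow_mul,
      ← zpow_add₀ h0]
    congr 1; push_cast; ring
  have e3 : p ^ (2 * ((n : ℤ) - j + 1)) = (p ^ n) ^ 2 * ((p ^ j)⁻¹) ^ 2 * p ^ 2 := by
    rw [mul_add, zpow_add₀ h0, e1]; norm_cast
  have e4 : p ^ (2 * ((n : ℤ) + j + 1)) = (p ^ n) ^ 2 * (p ^ j) ^ 2 * p ^ 2 := by
    rw [mul_add, zpow_add₀ h0, e2]; norm_cast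
  have e5 : p ^ ((j - 1) ^ 2) = p ^ (j ^ 2) * ((p ^ j)⁻¹) ^ 2 * p := by
    rw [show (j - 1) ^ 2 = j ^ 2 + (-j + -j) + 1 by ring, zpow_add₀ h0, zpow_add₀ h0, zpow_add₀ h0,
      _root_.zpow_neg, zpow_one]; ring
  have e6 : p ^ ((j + 1) ^ 2) = p ^ (j ^ 2) * (p ^ j) ^ 2 * p := by
    rw [show (j + 1) ^ 2 = j ^ 2 + (j + j) + 1 by ring, zpow_add₀ h0, zpow_add₀ h0, zpow_add₀ h0,
      zpow_one]; ring
  rw [e1, e2, e3, e4, e5, e6]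
  have hj : p ^ j ≠ 0 := zpow_ne_zero _ h0
  have f1 : p ^ (2 * (2 * n + 1)) = (p ^ n) ^ 4 * p ^ 2 := by ring
  have f2 : p ^ (2 * (2 * n + 1 + 1)) = (p ^ n) ^ 4 * p ^ 4 := by ring
  have f3 : p ^ (2 * n + 1) = (p ^ n) ^ 2 * p := by ring
  rw [f1, f2, f3]
  generalize p ^ n = s
  generalize p ^ (j ^ 2) = u
  generalize hw : p ^ j = w at hj ⊢
  field_simp
  ring

lemma tp_hasSum {p z : ℂ} (hp : ‖p‖ < 1) (h0 : p ≠ 0) (hz : z ≠ 0) (n : ℕ) :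
    HasSum (fun j : ℤ => tpC p n j * z ^ j)
      (∏ k ∈ Finset.range n, ((1 + z * p ^ (2 * k + 1)) * (1 + z⁻¹ * p ^ (2 * k + 1)))) := by
  induction n with
  | zero =>
    have : ∀ j : ℤ, j ≠ 0 → tpC p 0 j * z ^ j = 0 := by
      intro j hj
      unfold tpC tpDinv
      rcases lt_or_gt_of_ne hj with h | h
      · rw [if_pos (show ((0 : ℕ) : ℤ) + j < 0 by simpa using h)]; ring
      · rw [if_pos (show ((0 : ℕ) : ℤ) - j < 0 by simpa using h)]; ring
    have h2 := hasSum_single (0 : ℤ) this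
    simpa [tpC, tpDinv, tpD] using h2
  | succ n ih =>
    rw [Finset.prod_range_succ]
    set P := ∏ k ∈ Finset.range n, ((1 + z * p ^ (2 * k + 1)) * (1 + z⁻¹ * p ^ (2 * k + 1)))
    have h1 : HasSum (fun j : ℤ => tpC p n (j - 1) * z ^ j) (z * P) := by
      have := ((Equiv.subRight (1 : ℤ)).hasSum_iff.mpr ih).mul_left z
      refine this.congr_fun ?_ |> fun h => h
      intro j
      simp only [Function.comp, Equiv.subRight_apply]
      rw [zpow_sub_one₀ hz]; field_simp
    have h2 : HasSum (fun j : ℤ => tpC p n (j + 1) * z ^ j) (z⁻¹ * P) := by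
      have := ((Equiv.addRight (1 : ℤ)).hasSum_iff.mpr ih).mul_left z⁻¹
      refine this.congr_fun ?_ |> fun h => h
      intro j
      simp only [Function.comp, Equiv.coe_addRight]
      rw [zpow_add_one₀ hz]; field_simp
    have h3 := (ih.mul_left (1 + p ^ (2 * (2 * n + 1)))).add
      ((h1.add h2).mul_left (p ^ (2 * n + 1)))
    convert! h3 using 1
    · ext j
      rw [tpC_rec hp h0]; ring
    · field_simp
      ring
end

section
open Filter Topology

lemma summable_pow_odd {p : ℂ} (hp : ‖p‖ < 1) (a b : ℕ) (ha : a ≠ 0) :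
    Summable (fun k : ℕ => p ^ (a * k + b)) := by
  have : Summable (fun k : ℕ => p ^ b * (p ^ a) ^ k) := by
    have hh : ‖p ^ a‖ < 1 := by
      rw [norm_pow]; exact pow_lt_one₀ (norm_nonneg _) hp ha
    exact (summable_geometric_of_norm_lt_one (K := ℂ) hh).mul_left (p ^ b)
  refine this.congr fun k => ?_
  rw [← pow_mul, ← pow_add, add_comm]

lemma mult_add {p : ℂ} (hp : ‖p‖ < 1) (z : ℂ) (a b : ℕ) (ha : a ≠ 0) :
    Multipliable (fun k : ℕ => 1 + z * p ^ (a * k + b)) := by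
  apply multipliable_one_add_of_summable
  exact ((summable_pow_odd hp a b ha).mul_left z).norm

lemma mult_sub {p : ℂ} (hp : ‖p‖ < 1) (a b : ℕ) (ha : a ≠ 0) :
    Multipliable (fun k : ℕ => 1 - p ^ (a * k + b)) := by
  have := mult_add hp (-1) a b ha
  refine this.congr fun k => by ring

lemma mult_add1 {p : ℂ} (hp : ‖p‖ < 1) (a b : ℕ) (ha : a ≠ 0) :
    Multipliable (fun k : ℕ => 1 + p ^ (a * k + b)) := by
  have := mult_add hp 1 a b ha
  refine this.congr fun k => by ring

lemma tprod_sub_ne {p : ℂ} (hp : ‖p‖ < 1) (a b : ℕ) (ha : a ≠ 0) (hb : b ≠ 0) :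
    ∏' k : ℕ, (1 - p ^ (a * k + b)) ≠ 0 := by
  have := tprod_one_add_ne_zero_of_summable (f := fun k : ℕ => -p ^ (a * k + b))
    (fun k => by rw [← sub_eq_add_neg]; exact one_sub_pow_ne hp (by omega))
    (by simpa using (summable_pow_odd hp a b ha).norm)
  simpa [sub_eq_add_neg] using this

lemma tprod_add_ne {p : ℂ} (hp : ‖p‖ < 1) (a b : ℕ) (ha : a ≠ 0) (hb : b ≠ 0) :
    ∏' k : ℕ, (1 + p ^ (a * k + b)) ≠ 0 := by
  exact tprod_one_add_ne_zero_of_summable (f := fun k : ℕ => p ^ (a * k + b))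
    (fun k => one_add_pow_ne hp (by omega))
    (by simpa using (summable_pow_odd hp a b ha).norm)

lemma summable_theta {p z : ℂ} (hp : ‖p‖ < 1) (h0 : p ≠ 0) (hz : z ≠ 0) :
    Summable (fun j : ℤ => p ^ (j ^ 2) * z ^ j) := by
  have hpi : (Real.pi : ℂ) * Complex.I ≠ 0 := by simp [Real.pi_ne_zero]
  set τ : ℂ := Complex.log p / (Real.pi * Complex.I) with hτ
  set w : ℂ := Complex.log z / (2 * Real.pi * Complex.I) with hw
  have him : 0 < τ.im := by
    have : τ = (-(Complex.log p) * Complex.I) / (Real.pi : ℝ) := by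
      rw [hτ]; field_simp; rw [Complex.I_sq]; ring
    rw [this, Complex.div_ofReal_im]
    simp only [neg_mul, neg_im, mul_im, Complex.I_im, Complex.I_re, mul_one, mul_zero, add_zero, log_re]
    have := Real.log_neg (norm_pos_iff.mpr h0) hp
    apply div_pos _ Real.pi_pos
    linarith
  have h := (summable_jacobiTheta₂_term_iff w τ).mpr him
  refine h.congr fun j => ?_
  unfold jacobiTheta₂_term
  have e1 : cexp (Real.pi * Complex.I * τ) = p := by
    rw [hτ, mul_div_cancel₀ _ hpi, Complex.exp_log h0]
  have e2 : cexp (2 * Real.pi * Complex.I * w) = z := by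
    rw [hw, mul_div_cancel₀ _ (by simp [Real.pi_ne_zero]), Complex.exp_log hz]
  rw [← e1, ← e2, ← Complex.exp_int_mul, ← Complex.exp_int_mul, ← Complex.exp_add]
  congr 1; push_cast; ring

lemma tpD_tendsto {p : ℂ} (hp : ‖p‖ < 1) :
    Tendsto (tpD p) atTop (𝓝 (∏' k : ℕ, (1 - p ^ (2 * k + 2)))) := by
  have := (mult_sub hp 2 2 (by norm_num)).hasProd.tendsto_prod_nat
  refine this.congr fun n => ?_
  simp [tpD, mul_add]

theorem triple_product {p z : ℂ} (hp : ‖p‖ < 1) (h0 : p ≠ 0) (hz : z ≠ 0) :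
    ∑' j : ℤ, p ^ (j ^ 2) * z ^ j = (∏' k : ℕ, (1 - p ^ (2 * k + 2))) *
      ((∏' k : ℕ, (1 + z * p ^ (2 * k + 1))) * ∏' k : ℕ, (1 + z⁻¹ * p ^ (2 * k + 1))) := by
  set D := ∏' k : ℕ, (1 - p ^ (2 * k + 2)) with hD
  have hDne : D ≠ 0 := tprod_sub_ne hp 2 2 (by norm_num) (by norm_num)
  have hDt : Tendsto (tpD p) atTop (𝓝 D) := tpD_tendsto hp
  have hDi : Tendsto (fun n => (tpD p n)⁻¹) atTop (𝓝 D⁻¹) := hDt.inv₀ hDne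
  obtain ⟨M1, hM1⟩ := (Metric.isBounded_range_of_tendsto _ hDt).exists_norm_le
  obtain ⟨M2, hM2⟩ := (Metric.isBounded_range_of_tendsto _ hDi).exists_norm_le
  have hM1' : ∀ n, ‖tpD p n‖ ≤ M1 := fun n => hM1 _ ⟨n, rfl⟩
  have hM2' : ∀ m, ‖tpDinv p m‖ ≤ M2 := by
    intro m
    unfold tpDinv
    split_ifs
    · rw [norm_zero]; exact (norm_nonneg _).trans (hM2 _ ⟨0, rfl⟩)
    · exact hM2 _ ⟨_, rfl⟩
  have hM1n : 0 ≤ M1 := (norm_nonneg _).trans (hM1' 0)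
  have hM2n : 0 ≤ M2 := (norm_nonneg _).trans (hM2' 0)
  have hlim : Tendsto (fun n => ∑' j : ℤ, tpC p n j * z ^ j) atTop
      (𝓝 (∑' j : ℤ, p ^ (j ^ 2) * z ^ j * D⁻¹)) := by
    refine tendsto_tsum_of_dominated_convergence
      (bound := fun j : ℤ => M1 * M2 * M2 * ‖p ^ (j ^ 2) * z ^ j‖) ?_ ?_ ?_
    · exact (summable_theta hp h0 hz).norm.mul_left _
    · intro j
      have t1 : Tendsto (fun n : ℕ => tpD p (2 * n)) atTop (𝓝 D) :=
        hDt.comp (tendsto_atTop_mono (fun n => by simp; omega) tendsto_id)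
      have t2 : ∀ i : ℤ, Tendsto (fun n : ℕ => tpDinv p (n + i)) atTop (𝓝 D⁻¹) := by
        intro i
        have hh : Tendsto (fun n : ℕ => (((n : ℤ) + i).toNat)) atTop atTop := by
          rw [tendsto_atTop]
          intro b
          filter_upwards [eventually_ge_atTop (b + i.natAbs)] with n hn
          omega
        refine (hDi.comp hh).congr' ?_
        filter_upwards [eventually_ge_atTop (i.natAbs)] with n hn
        unfold tpDinv
        rw [if_neg (by omega)]
        rfl
      have t3 := ((((tendsto_const_nhds (x := p ^ (j ^ 2))).mul t1).mul (t2 (-j))).mul (t2 j)).mul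
        (tendsto_const_nhds (x := z ^ j))
      have e : p ^ (j ^ 2) * D * D⁻¹ * D⁻¹ * z ^ j = p ^ (j ^ 2) * z ^ j * D⁻¹ := by
        field_simp
      rw [e] at t3
      refine t3.congr fun n => ?_
      simp [tpC, sub_eq_add_neg]
    · refine Eventually.of_forall fun n j => ?_
      unfold tpC
      simp only [norm_mul]
      have k1 := hM1' (2 * n)
      have k2 := hM2' (n - j)
      have k3 := hM2' (n + j)
      calc _ = ‖tpD p (2 * n)‖ * ‖tpDinv p (n - j)‖ * ‖tpDinv p (n + j)‖ *
              (‖p ^ (j ^ 2)‖ * ‖z ^ j‖) := by ring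
        _ ≤ _ := by gcongr
  have hP : Tendsto (fun n => ∑' j : ℤ, tpC p n j * z ^ j) atTop
      (𝓝 ((∏' k : ℕ, (1 + z * p ^ (2 * k + 1))) * ∏' k : ℕ, (1 + z⁻¹ * p ^ (2 * k + 1)))) := by
    have m1 := mult_add hp z 2 1 (by norm_num)
    have m2 := mult_add hp z⁻¹ 2 1 (by norm_num)
    have := (m1.hasProd.mul m2.hasProd).tendsto_prod_nat
    refine this.congr fun n => ?_
    rw [(tp_hasSum hp h0 hz n).tsum_eq]
  have := tendsto_nhds_unique hlim hP
  rw [← this, tsum_mul_right]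
  field_simp

/-- `∑ p^{n²}` -/
def th3 (p : ℂ) : ℂ := ∑' n : ℤ, p ^ (n.natAbs ^ 2)
/-- `∑ p^{n(n+1)}` -/
def ps (p : ℂ) : ℂ := ∑' n : ℤ, p ^ ((n * (n + 1)).natAbs)

lemma natAbs_sq_cast (n : ℤ) : ((n.natAbs ^ 2 : ℕ) : ℤ) = n ^ 2 := by simp

lemma nn1_nonneg (n : ℤ) : 0 ≤ n * (n + 1) := by
  rcases lt_or_ge n 0 with h | h
  · nlinarith
  · positivity

lemma natAbs_nn1_cast (n : ℤ) : (((n * (n + 1)).natAbs : ℕ) : ℤ) = n ^ 2 + n := by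
  rw [Int.natAbs_of_nonneg (nn1_nonneg n)]; ring

lemma th3_term {p : ℂ} (n : ℤ) : p ^ (n.natAbs ^ 2) = p ^ (n ^ 2) * (1 : ℂ) ^ n := by
  rw [← zpow_natCast, natAbs_sq_cast]; simp

lemma ps_term {p : ℂ} (h0 : p ≠ 0) (n : ℤ) :
    p ^ ((n * (n + 1)).natAbs) = p ^ (n ^ 2) * p ^ n := by
  rw [← zpow_natCast, natAbs_nn1_cast, zpow_add₀ h0]

lemma th3_summable {p : ℂ} (hp : ‖p‖ < 1) : Summable fun n : ℤ => p ^ (n.natAbs ^ 2) := by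
  rcases eq_or_ne p 0 with rfl | h0
  · refine summable_of_hasFiniteSupport ((Set.finite_singleton (0 : ℤ)).subset ?_)
    intro n hn
    by_contra h
    exact hn (by simpa using h)
  · exact (summable_theta hp h0 one_ne_zero).congr fun n => (th3_term n).symm

lemma ps_summable {p : ℂ} (hp : ‖p‖ < 1) : Summable fun n : ℤ => p ^ ((n * (n + 1)).natAbs) := by
  rcases eq_or_ne p 0 with rfl | h0
  · refine summable_of_hasFiniteSupport ((Set.toFinite {(0 : ℤ), -1}).subset ?_)
    intro n hn
    by_contra h
    refine hn ?_
    simp only [Set.mem_insert_iff, Set.mem_singleton_iff, not_or] at h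
    show (0 : ℂ) ^ _ = 0
    rw [zero_pow]
    rw [Int.natAbs_ne_zero]
    refine mul_ne_zero h.1 ?_
    omega
  · exact (summable_theta hp h0 h0).congr fun n => (ps_term h0 n).symm

lemma th3_prod {p : ℂ} (hp : ‖p‖ < 1) (h0 : p ≠ 0) :
    th3 p = (∏' k : ℕ, (1 - p ^ (2 * k + 2))) * (∏' k : ℕ, (1 + p ^ (2 * k + 1))) ^ 2 := by
  have := triple_product hp h0 (one_ne_zero)
  simp only [inv_one, one_mul] at this
  rw [pow_two, ← this, th3]
  exact tsum_congr fun n => th3_term n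

lemma ps_prod {p : ℂ} (hp : ‖p‖ < 1) (h0 : p ≠ 0) :
    ps p = 2 * (∏' k : ℕ, (1 - p ^ (2 * k + 2))) * (∏' k : ℕ, (1 + p ^ (2 * k + 2))) ^ 2 := by
  have := triple_product hp h0 h0
  have e1 : ∀ k : ℕ, 1 + p * p ^ (2 * k + 1) = 1 + p ^ (2 * k + 2) := fun k => by ring
  have e2 : ∀ k : ℕ, 1 + p⁻¹ * p ^ (2 * k + 1) = 1 + p ^ (2 * k) := fun k => by
    rw [pow_succ]; field_simp
  simp only [e1, e2] at this
  have e3 : ∏' k : ℕ, (1 + p ^ (2 * k)) = 2 * ∏' k : ℕ, (1 + p ^ (2 * k + 2)) := by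
    have hm : Multipliable (fun k : ℕ => 1 + p ^ (2 * (k + 1))) := by
      simpa [mul_add] using mult_add1 hp 2 2 (by norm_num)
    have h5 := tprod_eq_zero_mul' (f := fun k : ℕ => 1 + p ^ (2 * k)) hm
    have h6 : (1 + p ^ (2 * 0)) = 2 := by norm_num
    rw [h5, h6]
    rfl
  rw [e3] at this
  unfold ps
  rw [tsum_congr (fun n => ps_term h0 n), this]
  ring

lemma th3_ne {p : ℂ} (hp : ‖p‖ < 1) : th3 p ≠ 0 := by
  rcases eq_or_ne p 0 with rfl | h0
  · have : th3 0 = 1 := by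
      unfold th3
      rw [tsum_eq_single 0]
      · simp
      · intro n hn
        simpa using hn
    simp [this]
  · rw [th3_prod hp h0]
    exact mul_ne_zero (tprod_sub_ne hp 2 2 (by norm_num) (by norm_num))
      (pow_ne_zero _ (tprod_add_ne hp 2 1 (by norm_num) (by norm_num)))

lemma ps_ne {p : ℂ} (hp : ‖p‖ < 1) (h0 : p ≠ 0) : ps p ≠ 0 := by
  rw [ps_prod hp h0]
  exact mul_ne_zero (mul_ne_zero two_ne_zero (tprod_sub_ne hp 2 2 (by norm_num) (by norm_num)))
      (pow_ne_zero _ (tprod_add_ne hp 2 2 (by norm_num) (by norm_num)))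
end

section
open Filter Topology

/-- `Q = q^{1/4}` -/
def QQ (τ : ℍ) : ℂ := qpow τ (1 / 4)

lemma QQ_ne (τ : ℍ) : QQ τ ≠ 0 := Complex.exp_ne_zero _

lemma norm_QQ (τ : ℍ) : ‖QQ τ‖ = Real.exp (-(Real.pi / 2) * τ.im) := by
  unfold QQ qpow
  rw [Complex.norm_exp]
  congr 1
  have : (2 * Real.pi * Complex.I * (1 / 4) * (τ : ℂ)) = ((Real.pi / 2 : ℝ) : ℂ) * (Complex.I * τ) := by
    push_cast; ring
  rw [this, Complex.re_ofReal_mul]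
  simp

lemma QQ_lt (τ : ℍ) : ‖QQ τ‖ < 1 := by
  rw [norm_QQ, Real.exp_lt_one_iff]
  have := τ.im_pos
  have := Real.pi_pos
  nlinarith

lemma qpow_int (τ : ℍ) (n : ℤ) (x : ℂ) (hx : x = n / 4) : qpow τ x = QQ τ ^ n := by
  unfold QQ qpow
  rw [← Complex.exp_int_mul, hx]; congr 1; ring

lemma qpow_nat (τ : ℍ) (n : ℕ) (x : ℂ) (hx : x = n / 4) : qpow τ x = QQ τ ^ n := by
  rw [← zpow_natCast]; exact qpow_int τ n x (by simpa using hx)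

lemma qpow_pow (τ : ℍ) (x : ℂ) (n : ℕ) : qpow τ x ^ n = qpow τ (n * x) := by
  unfold qpow
  rw [← Complex.exp_nat_mul]; congr 1; ring

lemma qpow_add (τ : ℍ) (x y : ℂ) : qpow τ (x + y) = qpow τ x * qpow τ y := by
  unfold qpow
  rw [← Complex.exp_add]; congr 1; ring

lemma qpow_neg (τ : ℍ) (x : ℂ) : qpow τ (-x) = (qpow τ x)⁻¹ := by
  unfold qpow
  rw [← Complex.exp_neg]; congr 1; ring

lemma shift_prod {p : ℂ} (hp : ‖p‖ < 1) (b : ℕ) :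
    (1 - p ^ b) * ∏' k : ℕ, (1 - p ^ (4 * k + (4 + b))) = ∏' k : ℕ, (1 - p ^ (4 * k + b)) := by
  have hm : Multipliable (fun k : ℕ => 1 - p ^ (4 * (k + 1) + b)) := by
    have := mult_sub hp 4 (4 + b) (by norm_num)
    refine this.congr fun k => ?_
    congr 2; ring
  have h5 := tprod_eq_zero_mul' (f := fun k : ℕ => 1 - p ^ (4 * k + b)) hm
  rw [h5]
  congr 1
  · simp
  · refine tprod_congr fun k => ?_
    congr 2; ring

lemma evenodd_prod {p : ℂ} (hp : ‖p‖ < 1) (a b : ℕ) (ha : a ≠ 0) :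
    (∏' k : ℕ, (1 - p ^ (2 * a * k + b))) * ∏' k : ℕ, (1 - p ^ (2 * a * k + (a + b)))
      = ∏' k : ℕ, (1 - p ^ (a * k + b)) := by
  have e1 : ∀ k : ℕ, 1 - p ^ (2 * a * k + b) = 1 - p ^ (a * (2 * k) + b) := fun k => by
    rw [show 2 * a * k + b = a * (2 * k) + b by ring]
  have e2 : ∀ k : ℕ, 1 - p ^ (2 * a * k + (a + b)) = 1 - p ^ (a * (2 * k + 1) + b) := fun k => by
    rw [show 2 * a * k + (a + b) = a * (2 * k + 1) + b by ring]
  have h1 : Multipliable (fun k : ℕ => 1 - p ^ (a * (2 * k) + b)) :=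
    (mult_sub hp (2 * a) b (by omega)).congr e1
  have h2 : Multipliable (fun k : ℕ => 1 - p ^ (a * (2 * k + 1) + b)) :=
    (mult_sub hp (2 * a) (a + b) (by omega)).congr e2
  rw [tprod_congr e1, tprod_congr e2]
  generalize hf : (fun k : ℕ => 1 - p ^ (a * k + b)) = f
  have hk : ∀ k, f k = 1 - p ^ (a * k + b) := fun k => by rw [← hf]
  simp only [← hk] at h1 h2 ⊢
  exact tprod_even_mul_odd h1 h2

lemma siegel_half (τ : ℍ) : siegel (1 / 2, 0) τ =
    -qpow τ (-1 / 24) * (∏' k : ℕ, (1 - QQ τ ^ (4 * k + 2))) ^ 2 := by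
  have hp := QQ_lt τ
  unfold siegel
  have e0 : ∀ n : ℕ, ((1 - qpow τ ((n : ℂ) + 1 + (((1 / 2 : ℚ), (0 : ℚ)).1 : ℂ)) * e2pi (((1 / 2 : ℚ), (0 : ℚ)).2 : ℂ)) *
       (1 - qpow τ ((n : ℂ) + 1 - (((1 / 2 : ℚ), (0 : ℚ)).1 : ℂ)) * e2pi (-(((1 / 2 : ℚ), (0 : ℚ)).2 : ℂ))))
      = (1 - QQ τ ^ (4 * n + (4 + 2))) * (1 - QQ τ ^ (4 * n + 2)) := by
    intro n
    rw [qpow_nat τ (4 * n + (4 + 2)) _ (by push_cast; ring), qpow_nat τ (4 * n + 2) _ (by push_cast; ring)]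
    simp [e2pi]
  rw [tprod_congr e0, (mult_sub hp 4 (4 + 2) (by norm_num)).tprod_mul (mult_sub hp 4 2 (by norm_num)),
    ← shift_prod hp 2, qpow_nat τ 2 ((((1 / 2 : ℚ), (0 : ℚ)).1 : ℂ)) (by push_cast; ring)]
  have e1 : (((((1 / 2 : ℚ), (0 : ℚ)).1 : ℂ)) ^ 2 - ((((1 / 2 : ℚ), (0 : ℚ)).1 : ℂ)) + 1 / 6) / 2 = -1 / 24 := by
    push_cast; norm_num
  rw [e1]
  simp [e2pi]
  ring

lemma siegel_quarter (τ : ℍ) : siegel (1 / 4, 0) τ =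
    -qpow τ (-1 / 96) * (∏' k : ℕ, (1 - QQ τ ^ (2 * k + 1))) := by
  have hp := QQ_lt τ
  unfold siegel
  have e0 : ∀ n : ℕ, ((1 - qpow τ ((n : ℂ) + 1 + (((1 / 4 : ℚ), (0 : ℚ)).1 : ℂ)) * e2pi (((1 / 4 : ℚ), (0 : ℚ)).2 : ℂ)) *
       (1 - qpow τ ((n : ℂ) + 1 - (((1 / 4 : ℚ), (0 : ℚ)).1 : ℂ)) * e2pi (-(((1 / 4 : ℚ), (0 : ℚ)).2 : ℂ))))
      = (1 - QQ τ ^ (4 * n + (4 + 1))) * (1 - QQ τ ^ (4 * n + 3)) := by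
    intro n
    rw [qpow_nat τ (4 * n + (4 + 1)) _ (by push_cast; ring), qpow_nat τ (4 * n + 3) _ (by push_cast; ring)]
    simp [e2pi]
  have h2 := evenodd_prod hp 2 1 (by norm_num)
  norm_num at h2
  rw [tprod_congr e0, (mult_sub hp 4 (4 + 1) (by norm_num)).tprod_mul (mult_sub hp 4 3 (by norm_num)),
    ← h2, ← shift_prod hp 1, qpow_nat τ 1 ((((1 / 4 : ℚ), (0 : ℚ)).1 : ℂ)) (by push_cast; ring)]
  have e1 : (((((1 / 4 : ℚ), (0 : ℚ)).1 : ℂ)) ^ 2 - ((((1 / 4 : ℚ), (0 : ℚ)).1 : ℂ)) + 1 / 6) / 2 = -1 / 96 := by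
    push_cast; norm_num
  rw [e1]
  simp [e2pi]
  ring

lemma g_prod (τ : ℍ) : g14slash τ = (QQ τ)⁻¹ * (∏' k : ℕ, (1 - QQ τ ^ (4 * k + 2))) ^ 16 /
    (∏' k : ℕ, (1 - QQ τ ^ (2 * k + 1))) ^ 8 := by
  unfold g14slash
  rw [siegel_half, siegel_quarter]
  have e1 : (-qpow τ (-1 / 24)) ^ 8 = (QQ τ)⁻¹ * (-qpow τ (-1 / 96)) ^ 8 := by
    rw [Even.neg_pow (by decide), Even.neg_pow (by decide), qpow_pow, qpow_pow, QQ, ← qpow_neg, ← qpow_add]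
    congr 1; norm_num
  have h1 : (-qpow τ (-1 / 96)) ≠ 0 := neg_ne_zero.mpr (Complex.exp_ne_zero _)
  rw [mul_pow, e1, inv_pow, mul_pow]
  set A := (-qpow τ (-1 / 96)) with hA
  have n1 := tprod_sub_ne (QQ_lt τ) 2 1 (by norm_num) (by norm_num)
  have n2 := QQ_ne τ
  field_simp

/-- Euler: products over `1 + p^{2k+2}` and `1 - p^{4k+2}` are inverse -/
lemma euler_prod {p : ℂ} (hp : ‖p‖ < 1) :
    (∏' k : ℕ, (1 + p ^ (2 * k + 2))) * ∏' k : ℕ, (1 - p ^ (4 * k + 2)) = 1 := by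
  have hC := tprod_sub_ne hp 4 4 (by norm_num) (by norm_num)
  have h1 : (∏' k : ℕ, (1 + p ^ (2 * k + 2))) * (∏' k : ℕ, (1 - p ^ (2 * k + 2))) =
      ∏' k : ℕ, (1 - p ^ (4 * k + 4)) := by
    rw [← (mult_add1 hp 2 2 (by norm_num)).tprod_mul (mult_sub hp 2 2 (by norm_num))]
    refine tprod_congr fun k => by ring
  have h2 := evenodd_prod hp 2 2 (by norm_num)
  norm_num at h2
  rw [← h2] at h1
  have : ((∏' k : ℕ, (1 + p ^ (2 * k + 2))) * ∏' k : ℕ, (1 - p ^ (4 * k + 2))) * ∏' k : ℕ, (1 - p ^ (4 * k + 4)) = 1 * ∏' k : ℕ, (1 - p ^ (4 * k + 4)) := by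
    rw [one_mul, mul_assoc, h1]
  exact mul_right_cancel₀ hC this

lemma EE_prod {p : ℂ} (hp : ‖p‖ < 1) :
    (∏' k : ℕ, (1 + p ^ (2 * k + 1))) * (∏' k : ℕ, (1 - p ^ (2 * k + 1))) =
      ∏' k : ℕ, (1 - p ^ (4 * k + 2)) := by
  rw [← (mult_add1 hp 2 1 (by norm_num)).tprod_mul (mult_sub hp 2 1 (by norm_num))]
  refine tprod_congr fun k => by ring

lemma g_theta (τ : ℍ) : g14slash τ = 16 * (QQ τ)⁻¹ * (th3 (QQ τ) / ps (QQ τ)) ^ 4 := by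
  have hp := QQ_lt τ
  have h0 := QQ_ne τ
  rw [g_prod, th3_prod hp h0, ps_prod hp h0]
  have h1 := euler_prod hp
  have h2 := EE_prod hp
  have n1 := tprod_sub_ne hp 2 1 (by norm_num) (by norm_num)
  have n2 := tprod_add_ne hp 2 2 (by norm_num) (by norm_num)
  have n3 := tprod_sub_ne hp 2 2 (by norm_num) (by norm_num)
  set D := ∏' k : ℕ, (1 - QQ τ ^ (2 * k + 2))
  set F := ∏' k : ℕ, (1 + QQ τ ^ (2 * k + 1))
  set E := ∏' k : ℕ, (1 - QQ τ ^ (2 * k + 1))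
  set G := ∏' k : ℕ, (1 + QQ τ ^ (2 * k + 2))
  set R := ∏' k : ℕ, (1 - QQ τ ^ (4 * k + 2))
  have hR : R = G⁻¹ := eq_inv_of_mul_eq_one_right h1
  have hF : F = R / E := by rw [← h2]; field_simp
  rw [hF, hR]
  field_simp
  norm_num
end

section
open Filter Topology

lemma tsum_parity {F : ℤ × ℤ → ℂ} (hF : Summable F) (c : ℤ) :
    ∑' x, F x = (∑' x : ℤ × ℤ, F (x.1 + x.2, x.1 - x.2)) +
      ∑' x : ℤ × ℤ, F (x.1 + x.2 + 1 + c, x.1 - x.2 + c) := by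
  have i1 : Function.Injective (fun x : ℤ × ℤ => (x.1 + x.2, x.1 - x.2)) := by
    rintro ⟨a, b⟩ ⟨a', b'⟩ h
    simp only [Prod.mk.injEq] at h ⊢
    omega
  have i2 : Function.Injective (fun x : ℤ × ℤ => (x.1 + x.2 + 1 + c, x.1 - x.2 + c)) := by
    rintro ⟨a, b⟩ ⟨a', b'⟩ h
    simp only [Prod.mk.injEq] at h ⊢
    omega
  have hc : IsCompl (Set.range (fun x : ℤ × ℤ => (x.1 + x.2, x.1 - x.2)))
      (Set.range (fun x : ℤ × ℤ => (x.1 + x.2 + 1 + c, x.1 - x.2 + c))) := by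
    constructor
    · rw [Set.disjoint_left]
      rintro _ ⟨⟨a, b⟩, rfl⟩ ⟨⟨a', b'⟩, h⟩
      simp only [Prod.mk.injEq] at h
      omega
    · rw [codisjoint_iff_le_sup]
      rintro ⟨a, b⟩ -
      rcases Int.even_or_odd' (a + b) with ⟨k, hk | hk⟩
      · left; exact ⟨(k, a - k), by simp only [Prod.mk.injEq]; omega⟩
      · right; exact ⟨(k - c, a - k - 1), by simp only [Prod.mk.injEq]; omega⟩
  have h1 : HasSum (fun x : ℤ × ℤ => F (x.1 + x.2, x.1 - x.2)) _ := (hF.comp_injective i1).hasSum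
  have h2 : HasSum (fun x : ℤ × ℤ => F (x.1 + x.2 + 1 + c, x.1 - x.2 + c)) _ := (hF.comp_injective i2).hasSum
  exact (HasSum.add_isCompl hc ((i1.hasSum_range_iff (f := F)).mpr h1) ((i2.hasSum_range_iff (f := F)).mpr h2)).tsum_eq

lemma mul_tsum_prod {f g : ℤ → ℂ} (hf : Summable f) (hg : Summable g) :
    (∑' n, f n) * (∑' n, g n) = ∑' x : ℤ × ℤ, f x.1 * g x.2 :=
  tsum_mul_tsum_of_summable_norm hf.norm hg.norm

lemma summ_prod {f g : ℤ → ℂ} (hf : Summable f) (hg : Summable g) :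
    Summable (fun x : ℤ × ℤ => f x.1 * g x.2) :=
  summable_mul_of_summable_norm hf.norm hg.norm

lemma sq_lt {p : ℂ} (hp : ‖p‖ < 1) : ‖p ^ 2‖ < 1 := by
  rw [norm_pow]; exact pow_lt_one₀ (norm_nonneg _) hp (by norm_num)

lemma landen_th {p : ℂ} (hp : ‖p‖ < 1) : th3 p ^ 2 = th3 (p ^ 2) ^ 2 + p * ps (p ^ 2) ^ 2 := by
  have s1 := th3_summable hp
  have s2 := th3_summable (sq_lt hp)
  have s3 := ps_summable (sq_lt hp)
  rw [pow_two, pow_two, pow_two (ps _)]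
  unfold th3 ps
  rw [mul_tsum_prod s1 s1, tsum_parity (summ_prod s1 s1) 0, mul_tsum_prod s2 s2, mul_tsum_prod s3 s3,
    ← tsum_mul_left]
  congr 1
  · refine tsum_congr fun x => ?_
    rw [← pow_add, ← pow_mul, ← pow_mul, ← pow_add]
    congr 1
    zify
    simp only [sq_abs]
    ring
  · refine tsum_congr fun x => ?_
    rw [← pow_add, ← pow_mul, ← pow_mul, ← pow_add, ← pow_succ']
    congr 1
    have h1 := natAbs_nn1_cast x.1
    have h2 := natAbs_nn1_cast x.2
    have h3 := natAbs_sq_cast (x.1 + x.2 + 1 + 0)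
    have h4 := natAbs_sq_cast (x.1 - x.2 + 0)
    apply Int.ofNat_inj.mp
    push_cast at *
    rw [h1, h2, h3, h4]
    ring

lemma landen_ps {p : ℂ} (hp : ‖p‖ < 1) : ps p ^ 2 = 2 * th3 (p ^ 2) * ps (p ^ 2) := by
  have s1 := ps_summable hp
  have s2 := th3_summable (sq_lt hp)
  have s3 := ps_summable (sq_lt hp)
  rw [pow_two, mul_assoc, two_mul]
  nth_rewrite 3 [mul_comm]
  unfold th3 ps
  rw [mul_tsum_prod s1 s1, tsum_parity (summ_prod s1 s1) (-1), mul_tsum_prod s2 s3, mul_tsum_prod s3 s2, add_comm]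
  congr 1
  · refine tsum_congr fun x => ?_
    rw [← pow_add, ← pow_mul, ← pow_mul, ← pow_add]
    congr 1
    have h1 := natAbs_nn1_cast (x.1 + x.2 + 1 + -1)
    have h2 := natAbs_nn1_cast (x.1 - x.2 + -1)
    have h3 := natAbs_sq_cast x.1
    have h4 := natAbs_nn1_cast x.2
    apply Int.ofNat_inj.mp
    push_cast at *
    rw [h1, h2, h3, h4]
    ring
  · refine tsum_congr fun x => ?_
    rw [← pow_add, ← pow_mul, ← pow_mul, ← pow_add]
    congr 1
    have h1 := natAbs_nn1_cast (x.1 + x.2)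
    have h2 := natAbs_nn1_cast (x.1 - x.2)
    have h3 := natAbs_sq_cast x.2
    have h4 := natAbs_nn1_cast x.1
    apply Int.ofNat_inj.mp
    push_cast at *
    rw [h1, h2, h3, h4]
    ring

lemma ps_neg (p : ℂ) : ps (-p) = ps p := by
  unfold ps
  refine tsum_congr fun n => ?_
  have : Even ((n * (n + 1)).natAbs) := by rw [Int.natAbs_even]; exact Int.even_mul_succ_self n
  exact this.neg_pow p

lemma landen_th' {p : ℂ} (hp : ‖p‖ < 1) : th3 (-p) ^ 2 = th3 (p ^ 2) ^ 2 - p * ps (p ^ 2) ^ 2 := by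
  have := landen_th (p := -p) (by simpa using hp)
  rw [this, neg_sq]; ring

/-- `x = θ₂²/θ₃²` -/
def xx (τ : ℍ) : ℂ := QQ τ * ps (QQ τ ^ 2) ^ 2 / th3 (QQ τ ^ 2) ^ 2
/-- `y = θ₄²/θ₃²` -/
def yy (τ : ℍ) : ℂ := th3 (-QQ τ ^ 2) ^ 2 / th3 (QQ τ ^ 2) ^ 2

/-- `φ(u) = 4(1+u)²/u` -/
def phi (u : ℂ) : ℂ := 4 * (1 + u) ^ 2 / u

lemma phi_inv (u : ℂ) : phi u⁻¹ = phi u := by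
  unfold phi
  rcases eq_or_ne u 0 with rfl | h
  · simp
  · field_simp
    ring

lemma xx_ne (τ : ℍ) : xx τ ≠ 0 := by
  have h := sq_lt (QQ_lt τ)
  exact div_ne_zero (mul_ne_zero (QQ_ne τ) (pow_ne_zero _ (ps_ne h (pow_ne_zero _ (QQ_ne τ)))))
    (pow_ne_zero _ (th3_ne h))

lemma yy_ne (τ : ℍ) : yy τ ≠ 0 := by
  have h := sq_lt (QQ_lt τ)
  exact div_ne_zero (pow_ne_zero _ (th3_ne (by simpa using h))) (pow_ne_zero _ (th3_ne h))

lemma g_phi (τ : ℍ) : g14slash τ = phi (xx τ) := by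
  have hp := QQ_lt τ
  have h := sq_lt hp
  have n1 := QQ_ne τ
  have n2 := th3_ne h
  have n3 := ps_ne h (pow_ne_zero 2 n1)
  have n4 := ps_ne hp n1
  rw [g_theta, phi, xx, div_pow, show (4 : ℕ) = 2 * 2 by norm_num, pow_mul, pow_mul, landen_th hp, landen_ps hp]
  field_simp
  ring

lemma g_sub (τ : ℍ) : g14slash τ - 16 = 16 * (QQ τ)⁻¹ * (th3 (-QQ τ) / ps (QQ τ)) ^ 4 := by
  have hp := QQ_lt τ
  have h := sq_lt hp
  have n1 := QQ_ne τ
  have n2 := th3_ne h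
  have n3 := ps_ne h (pow_ne_zero 2 n1)
  have n4 := ps_ne hp n1
  rw [g_theta, div_pow, div_pow, show (4 : ℕ) = 2 * 2 by norm_num, pow_mul, pow_mul, pow_mul, landen_th hp, landen_th' hp, landen_ps hp]
  field_simp
  ring

lemma g_ne (τ : ℍ) : g14slash τ ≠ 0 := by
  have hp := QQ_lt τ
  have n1 := QQ_ne τ
  rw [g_theta]
  exact mul_ne_zero (mul_ne_zero (by norm_num) (inv_ne_zero n1)) (pow_ne_zero _ (div_ne_zero (th3_ne hp) (ps_ne hp n1)))

lemma g_sub_ne (τ : ℍ) : g14slash τ - 16 ≠ 0 := by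
  have hp := QQ_lt τ
  have n1 := QQ_ne τ
  rw [g_sub]
  exact mul_ne_zero (mul_ne_zero (by norm_num) (inv_ne_zero n1)) (pow_ne_zero _ (div_ne_zero (th3_ne (by simpa using hp)) (ps_ne hp n1)))

/-! theta transformation -/

lemma QQ_exp (τ : ℍ) : QQ τ ^ 2 = cexp (Real.pi * Complex.I * τ) := by
  unfold QQ
  rw [qpow_pow, qpow]; congr 1; push_cast; ring

lemma jt_zero (τ : ℍ) : jacobiTheta₂ 0 τ = th3 (QQ τ ^ 2) := by
  unfold jacobiTheta₂ th3
  refine tsum_congr fun n => ?_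
  rw [jacobiTheta₂_term, QQ_exp, th3_term, ← Complex.exp_int_mul]
  simp
  congr 1; ring

lemma jt_half (τ : ℍ) : jacobiTheta₂ (1 / 2) τ = th3 (-QQ τ ^ 2) := by
  unfold jacobiTheta₂ th3
  refine tsum_congr fun n => ?_
  rw [jacobiTheta₂_term, QQ_exp, th3_term, neg_eq_neg_one_mul, mul_zpow, ← Complex.exp_int_mul, _root_.one_zpow, mul_one,
    Complex.exp_add]
  congr 1
  · rw [show 2 * Real.pi * Complex.I * n * (1 / 2) = n * (Real.pi * Complex.I) by ring, Complex.exp_int_mul, Complex.exp_pi_mul_I]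
    rcases Int.even_or_odd n with h | h
    · rw [h.neg_one_zpow, Even.neg_one_zpow]
      exact h.pow_of_ne_zero (by norm_num)
    · rw [h.neg_one_zpow, Odd.neg_one_zpow]
      exact h.pow
  · congr 1; push_cast; ring

lemma jt_tau (τ : ℍ) : jacobiTheta₂ (τ / 2) τ = ps (QQ τ ^ 2) := by
  unfold jacobiTheta₂ ps
  refine tsum_congr fun n => ?_
  rw [jacobiTheta₂_term, ps_term (pow_ne_zero _ (QQ_ne τ)), QQ_exp, ← Complex.exp_int_mul, ← Complex.exp_int_mul, ← Complex.exp_add]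
  congr 1; push_cast; ring

lemma S_coe (τ : ℍ) : ((ModularGroup.S • τ : ℍ) : ℂ) = -1 / τ := by
  rw [UpperHalfPlane.modular_S_smul]
  simp [neg_div]; 

lemma T_coe (τ : ℍ) : ((ModularGroup.T • τ : ℍ) : ℂ) = τ + 1 := by
  rw [UpperHalfPlane.modular_T_smul]
  simp [add_comm]

lemma exp_quarter : cexp (Real.pi / 2 * Complex.I) = Complex.I := Complex.exp_pi_div_two_mul_I

lemma QQ_T (τ : ℍ) : QQ (ModularGroup.T • τ) = Complex.I * QQ τ := by
  unfold QQ qpow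
  have := exp_quarter
  nth_rewrite 2 [← this]
  rw [T_coe, ← Complex.exp_add]; congr 1; ring

lemma xx_T (τ : ℍ) : xx (ModularGroup.T • τ) = Complex.I * (xx τ / yy τ) := by
  have h := sq_lt (QQ_lt τ)
  have n2 := th3_ne h
  have n3 : th3 (-QQ τ ^ 2) ≠ 0 := th3_ne (by simpa using h)
  unfold xx yy
  rw [QQ_T, mul_pow, Complex.I_sq, neg_one_mul, ps_neg]
  field_simp

lemma yy_T (τ : ℍ) : yy (ModularGroup.T • τ) = (yy τ)⁻¹ := by
  unfold yy
  rw [QQ_T, mul_pow, Complex.I_sq, neg_one_mul, neg_neg, inv_div]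

lemma fe (z : ℂ) (τ : ℍ) : jacobiTheta₂ z τ = 1 / (-Complex.I * τ) ^ (1 / 2 : ℂ) *
    cexp (-Real.pi * Complex.I * z ^ 2 / τ) * jacobiTheta₂ (z / τ) (ModularGroup.S • τ : ℍ) := by
  rw [jacobiTheta₂_functional_equation, S_coe]

lemma xx_S (τ : ℍ) : xx (ModularGroup.S • τ) = yy τ := by
  have ht : (τ : ℂ) ≠ 0 := τ.ne_zero
  have h := sq_lt (QQ_lt (ModularGroup.S • τ))
  have n2 := th3_ne h
  have h1 := fe 0 τ
  have h2 := fe (1 / 2) τ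
  have hc : (1 / (-Complex.I * τ) ^ (1 / 2 : ℂ)) ≠ 0 := by
    apply one_div_ne_zero
    rw [Complex.cpow_def_of_ne_zero (by simp [ht])]
    exact Complex.exp_ne_zero _
  have e1 : (1 / 2 : ℂ) / τ = -(((ModularGroup.S • τ : ℍ) : ℂ) / 2) := by rw [S_coe]; field_simp
  have e2 : QQ (ModularGroup.S • τ) = cexp (-Real.pi * Complex.I * (1 / 2) ^ 2 / τ) ^ 2 := by
    unfold QQ qpow
    rw [S_coe, ← Complex.exp_nat_mul]; congr 1; push_cast; field_simp; norm_num
  rw [e1, jacobiTheta₂_neg_left, jt_tau, jt_half] at h2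
  rw [zero_div, jt_zero, jt_zero] at h1
  unfold xx yy
  rw [h1, h2, e2]
  simp
  field_simp

lemma QQ_SS (τ : ℍ) : ModularGroup.S • ModularGroup.S • τ = τ := by
  ext
  rw [S_coe, S_coe]
  have ht : (τ : ℂ) ≠ 0 := τ.ne_zero
  field_simp

lemma yy_S (τ : ℍ) : yy (ModularGroup.S • τ) = xx τ := by
  rw [← xx_S, QQ_SS]
end

section
open Filter Topology

/-- the six possible transforms of `x` -/
def uTab (i : Fin 6) (x y : ℂ) : ℂ :=
  match i with
  | 0 => x
  | 1 => Complex.I * (x / y)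
  | 2 => -x
  | 3 => -(Complex.I * (x / y))
  | 4 => y
  | 5 => -y

/-- index attached to a top row modulo 4 -/
def rIdx (a b : ZMod 4) : Fin 6 :=
  if a = 0 then 4 else if a = 2 then 5 else if a * b = 0 then 0 else if a * b = 1 then 1
  else if a * b = 2 then 2 else 3

def sIdx (i : Fin 6) : Fin 6 :=
  match i with
  | 0 => 4 | 1 => 3 | 2 => 5 | 3 => 1 | 4 => 0 | 5 => 2

def tIdx (i : Fin 6) : Fin 6 :=
  match i with
  | 0 => 1 | 1 => 2 | 2 => 3 | 3 => 0 | 4 => 4 | 5 => 5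

lemma rIdx_S : ∀ a b : ZMod 4, (2 * a ≠ 0 ∨ 2 * b ≠ 0) → rIdx b (-a) = sIdx (rIdx a b) := by decide

lemma rIdx_T : ∀ a b : ZMod 4, (2 * a ≠ 0 ∨ 2 * b ≠ 0) → rIdx a (a + b) = tIdx (rIdx a b) := by decide

lemma uTab_S (i : Fin 6) (x y : ℂ) (hx : x ≠ 0) (hy : y ≠ 0) :
    phi (uTab i y x) = phi (uTab (sIdx i) x y) := by
  have h : (Complex.I * (y / x)) = (-(Complex.I * (x / y)))⁻¹ := by
    field_simp; rw [Complex.I_sq]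
  have h' : (-(Complex.I * (y / x))) = ((Complex.I * (x / y)))⁻¹ := by
    field_simp; rw [Complex.I_sq]; norm_num
  fin_cases i
  · rfl
  · show phi (Complex.I * (y / x)) = phi (-(Complex.I * (x / y)))
    rw [h, phi_inv]
  · rfl
  · show phi (-(Complex.I * (y / x))) = phi ((Complex.I * (x / y)))
    rw [h', phi_inv]
  · rfl
  · rfl

lemma uTab_T (i : Fin 6) (x y : ℂ) (hy : y ≠ 0) :
    phi (uTab i (Complex.I * (x / y)) y⁻¹) = phi (uTab (tIdx i) x y) := by
  fin_cases i
  · rfl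
  · show phi (Complex.I * (Complex.I * (x / y) / y⁻¹)) = phi (-x)
    congr 1; field_simp; rw [Complex.I_sq]; ring
  · rfl
  · show phi (-(Complex.I * (Complex.I * (x / y) / y⁻¹))) = phi (x)
    congr 1; field_simp; rw [Complex.I_sq]; ring
  · exact phi_inv y
  · show phi (-y⁻¹) = phi (-y)
    rw [← phi_inv (-y), inv_neg]

/-- index of a matrix -/
def mIdx (γ : SL2Z) : Fin 6 := rIdx ((γ 0 0 : ℤ) : ZMod 4) ((γ 0 1 : ℤ) : ZMod 4)

lemma row_prim (γ : SL2Z) : 2 * ((γ 0 0 : ℤ) : ZMod 4) ≠ 0 ∨ 2 * ((γ 0 1 : ℤ) : ZMod 4) ≠ 0 := by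
  by_contra h
  push Not at h
  have hd := Matrix.det_fin_two γ.1
  rw [γ.2] at hd
  have hd' : (1 : ZMod 4) = ((γ 0 0 : ℤ) : ZMod 4) * ((γ 1 1 : ℤ) : ZMod 4) -
      ((γ 0 1 : ℤ) : ZMod 4) * ((γ 1 0 : ℤ) : ZMod 4) := by
    have := congrArg (fun z : ℤ => (z : ZMod 4)) hd
    simpa using this
  have : (2 : ZMod 4) = 0 := by
    linear_combination 2 * hd' + ((γ 1 1 : ℤ) : ZMod 4) * h.1 - ((γ 1 0 : ℤ) : ZMod 4) * h.2
  exact absurd this (by decide)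

lemma mul_entry (γ σ : SL2Z) (i j : Fin 2) : ((γ * σ) i j : ℤ) = γ i 0 * σ 0 j + γ i 1 * σ 1 j := by
  show (γ.1 * σ.1) i j = _
  rw [Matrix.mul_apply, Fin.sum_univ_two]

lemma mIdx_S (γ : SL2Z) : mIdx (γ * ModularGroup.S) = sIdx (mIdx γ) := by
  unfold mIdx
  rw [← rIdx_S _ _ (row_prim γ)]
  congr 1 <;> rw [mul_entry] <;> simp [ModularGroup.S]

lemma mIdx_T (γ : SL2Z) : mIdx (γ * ModularGroup.T) = tIdx (mIdx γ) := by
  unfold mIdx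
  rw [← rIdx_T _ _ (row_prim γ)]
  congr 1 <;> rw [mul_entry] <;> simp [ModularGroup.T]

lemma orbit_aux (σ : SL2Z) : ∀ (γ : SL2Z) (τ : ℍ),
    phi (uTab (mIdx γ) (xx (σ • τ)) (yy (σ • τ))) = phi (uTab (mIdx (γ * σ)) (xx τ) (yy τ)) := by
  have hσ : σ ∈ Subgroup.closure ({ModularGroup.S, ModularGroup.T} : Set SL2Z) := by
    rw [SpecialLinearGroup.SL2Z_generators]; trivial
  induction hσ using Subgroup.closure_induction with
  | mem σ h =>
    intro γ τ
    rcases h with rfl | rfl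
    · rw [xx_S, yy_S, mIdx_S, uTab_S _ _ _ (xx_ne τ) (yy_ne τ)]
    · rw [xx_T, yy_T, mIdx_T, uTab_T _ _ _ (yy_ne τ)]
  | one => intro γ τ; simp
  | mul a b _ _ ha hb =>
    intro γ τ
    rw [mul_smul, ha, hb, mul_assoc]
  | inv a _ ha =>
    intro γ τ
    have := ha (γ * a⁻¹) (a⁻¹ • τ)
    rw [smul_inv_smul, inv_mul_cancel_right] at this
    exact this.symm

lemma g_orbit (σ : SL2Z) (τ : ℍ) : g14slash (σ • τ) = phi (uTab (mIdx σ) (xx τ) (yy τ)) := by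
  have := orbit_aux σ 1 τ
  rw [one_mul] at this
  rw [g_phi, ← this]
  rfl

lemma g_modular (γ : SL2Z) (h : InGamma1Lower 4 γ) (τ : ℍ) : g14slash (γ • τ) = g14slash τ := by
  rw [g_orbit, mIdx, h.1, h.2.1, g_phi]
  rfl
end

section
open Filter Topology

/-- the power series `p` converges near zero to `F` -/
def PRep (p : PowerSeries ℂ) (F : ℂ → ℂ) : Prop :=
  ∀ᶠ z in 𝓝 (0 : ℂ), HasSum (fun n => PowerSeries.coeff n p * z ^ n) (F z)

lemma PRep.congr {p : PowerSeries ℂ} {F G : ℂ → ℂ} (h : PRep p F) (hG : ∀ᶠ z in 𝓝 0, F z = G z) : PRep p G := by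
  filter_upwards [h, hG] with z h1 h2
  rwa [← h2]

lemma PRep.at_zero {p : PowerSeries ℂ} {F : ℂ → ℂ} (h : PRep p F) : F 0 = PowerSeries.constantCoeff p := by
  have h0 := h.self_of_nhds
  have h1 : HasSum (fun n => PowerSeries.coeff n p * (0 : ℂ) ^ n) (PowerSeries.coeff 0 p * 0 ^ 0) := by
    apply hasSum_single 0
    intro n hn
    simp [hn]
  have := h0.unique h1
  simpa using this

lemma PRep.add {p q : PowerSeries ℂ} {F G : ℂ → ℂ} (h : PRep p F) (h' : PRep q G) :
    PRep (p + q) (fun z => F z + G z) := by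
  filter_upwards [h, h'] with z h1 h2
  refine (h1.add h2).congr_fun ?_
  intro n; simp [add_mul]

lemma PRep.mul {p q : PowerSeries ℂ} {F G : ℂ → ℂ} (h : PRep p F) (h' : PRep q G) :
    PRep (p * q) (fun z => F z * G z) := by
  filter_upwards [h, h'] with z h1 h2
  have n1 := h1.summable.norm
  have n2 := h2.summable.norm
  have e := tsum_mul_tsum_eq_tsum_sum_antidiagonal_of_summable_norm n1 n2
  have s := (summable_norm_sum_mul_antidiagonal_of_summable_norm n1 n2).of_norm.hasSum
  rw [← e, h1.tsum_eq, h2.tsum_eq] at s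
  refine s.congr_fun ?_
  intro n
  rw [PowerSeries.coeff_mul, Finset.sum_mul]
  refine Finset.sum_congr rfl fun x hx => ?_
  rw [← Finset.HasAntidiagonal.mem_antidiagonal.mp hx, pow_add]; ring

lemma prep_C (a : ℂ) : PRep (PowerSeries.C a) (fun _ => a) := by
  refine Eventually.of_forall fun z => ?_
  have := hasSum_single (f := fun n => PowerSeries.coeff n (PowerSeries.C a) * z ^ n) 0 (by
    intro n hn; simp [PowerSeries.coeff_C, hn])
  simpa using this

lemma prep_X : PRep PowerSeries.X (fun z => z) := by
  refine Eventually.of_forall fun z => ?_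
  have := hasSum_single (f := fun n => PowerSeries.coeff n (PowerSeries.X : PowerSeries ℂ) * z ^ n) 1 (by
    intro n hn; simp [PowerSeries.coeff_X, hn])
  simpa using this

lemma PRep.pow {p : PowerSeries ℂ} {F : ℂ → ℂ} (h : PRep p F) (n : ℕ) : PRep (p ^ n) (fun z => F z ^ n) := by
  induction n with
  | zero => simpa using prep_C 1
  | succ n ih => simp only [pow_succ]; exact ih.mul h

lemma PRep.hasF {p : PowerSeries ℂ} {F : ℂ → ℂ} (h : PRep p F) :
    HasFPowerSeriesAt F (FormalMultilinearSeries.ofScalars ℂ (fun n => PowerSeries.coeff n p)) 0 := by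
  rw [hasFPowerSeriesAt_iff]
  filter_upwards [h] with z hz
  rw [zero_add]
  refine hz.congr_fun ?_
  intro n
  rw [FormalMultilinearSeries.coeff_ofScalars, smul_eq_mul, mul_comm]

lemma PRep.unique {p q : PowerSeries ℂ} {F : ℂ → ℂ} (h : PRep p F) (h' : PRep q F) : p = q := by
  have := h.hasF.eq_formalMultilinearSeries h'.hasF
  ext n
  have h2 := congrArg (fun s => FormalMultilinearSeries.coeff s n) this
  simpa [FormalMultilinearSeries.coeff_ofScalars] using h2

lemma PRep.of_hasF {s : FormalMultilinearSeries ℂ ℂ ℂ} {F : ℂ → ℂ} (h : HasFPowerSeriesAt F s 0) :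
    PRep (PowerSeries.mk fun n => s.coeff n) F := by
  rw [hasFPowerSeriesAt_iff] at h
  filter_upwards [h] with z hz
  rw [zero_add] at hz
  refine hz.congr_fun ?_
  intro n
  rw [PowerSeries.coeff_mk, smul_eq_mul, mul_comm]

lemma PRep.inv {p q : PowerSeries ℂ} {F : ℂ → ℂ} (h : PRep p F) (hpq : p * q = 1) :
    PRep q (fun z => (F z)⁻¹) := by
  have hc : PowerSeries.constantCoeff p ≠ 0 := by
    intro h0
    have := congrArg PowerSeries.constantCoeff hpq
    rw [map_mul, h0, zero_mul, map_one] at this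
    exact zero_ne_one this
  have hF0 : F 0 ≠ 0 := by rwa [h.at_zero]
  have han : AnalyticAt ℂ F 0 := ⟨_, h.hasF⟩
  obtain ⟨s, hs⟩ := han.inv hF0
  have hr := PRep.of_hasF hs
  have h1 : PRep (p * PowerSeries.mk fun n => s.coeff n) (fun _ => 1) := by
    refine (h.mul hr).congr ?_
    filter_upwards [han.continuousAt.eventually_ne hF0] with z hz
    simp [hz]
  have h2 := h1.unique (by simpa using prep_C 1)
  have : q = PowerSeries.mk fun n => s.coeff n := by
    calc q = q * (p * PowerSeries.mk fun n => s.coeff n) := by rw [h2, mul_one]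
      _ = (p * q) * PowerSeries.mk fun n => s.coeff n := by ring
      _ = _ := by rw [hpq, one_mul]
  rw [this]; exact hr

lemma PRep.divX {q : PowerSeries ℂ} {F : ℂ → ℂ} (h : PRep (PowerSeries.X * q) F) :
    ∃ G, PRep q G ∧ ∀ z, z ≠ 0 → F z = z * G z := by
  refine ⟨fun z => if z = 0 then PowerSeries.constantCoeff q else F z / z, ?_, ?_⟩
  · filter_upwards [h] with z hz
    by_cases h0 : z = 0
    · subst h0
      have h1 : HasSum (fun n => PowerSeries.coeff n q * (0 : ℂ) ^ n) (PowerSeries.coeff 0 q * 0 ^ 0) := by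
        apply hasSum_single 0
        intro n hn
        simp [hn]
      simpa using h1
    · rw [if_neg h0]
      have := (hasSum_nat_add_iff' 1).mpr hz
      simp only [Finset.range_one, Finset.sum_singleton, PowerSeries.coeff_zero_X_mul, zero_mul, sub_zero] at this
      refine (this.div_const z).congr_fun ?_
      intro n
      rw [PowerSeries.coeff_succ_X_mul]
      field_simp
      ring
  · intro z hz
    show F z = z * (if z = 0 then _ else F z / z)
    rw [if_neg hz]
    field_simp

lemma PRep.rescale {p : PowerSeries ℂ} {F : ℂ → ℂ} (h : PRep p F) (a : ℂ) :
    PRep (PowerSeries.rescale a p) (fun z => F (a * z)) := by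
  have ht : Tendsto (fun z : ℂ => a * z) (𝓝 0) (𝓝 0) := by
    have : Continuous (fun z : ℂ => a * z) := by fun_prop
    simpa using this.tendsto 0
  filter_upwards [ht.eventually h] with z hz
  refine hz.congr_fun ?_
  intro n
  rw [PowerSeries.coeff_rescale, mul_pow]; ring

lemma QQ_tendsto : Tendsto QQ atImInfty (𝓝 0) := by
  rw [tendsto_zero_iff_norm_tendsto_zero]
  simp only [norm_QQ]
  have h1 : Tendsto (fun τ : ℍ => τ.im) atImInfty atTop := tendsto_comap
  have : Tendsto (fun τ : ℍ => -(Real.pi / 2) * τ.im) atImInfty atBot :=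
    h1.const_mul_atTop_of_neg (by have := Real.pi_pos; linarith)
  exact Real.tendsto_exp_atBot.comp this

section LEsec
variable {K : Type} [Field K] [Algebra K ℂ]

/-- `Q^k f` is given by the power series `p` in `Q` near `i∞` -/
def LP (k : ℕ) (p : PowerSeries K) (f : ℍ → ℂ) : Prop :=
  ∃ F, PRep (p.map (algebraMap K ℂ)) F ∧ ∀ᶠ τ in atImInfty, QQ τ ^ k * f τ = F (QQ τ)

lemma LP.mul {k l : ℕ} {p q : PowerSeries K} {f g : ℍ → ℂ} (h : LP k p f) (h' : LP l q g) :
    LP (k + l) (p * q) (fun τ => f τ * g τ) := by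
  obtain ⟨F, hF, eF⟩ := h
  obtain ⟨G, hG, eG⟩ := h'
  refine ⟨_, by rw [map_mul]; exact hF.mul hG, ?_⟩
  filter_upwards [eF, eG] with τ h1 h2
  rw [← h1, ← h2]; ring

lemma LP.add {k : ℕ} {p q : PowerSeries K} {f g : ℍ → ℂ} (h : LP k p f) (h' : LP k q g) :
    LP k (p + q) (fun τ => f τ + g τ) := by
  obtain ⟨F, hF, eF⟩ := h
  obtain ⟨G, hG, eG⟩ := h'
  refine ⟨_, by rw [map_add]; exact hF.add hG, ?_⟩
  filter_upwards [eF, eG] with τ h1 h2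
  rw [← h1, ← h2]; ring

lemma LP.const (a : K) : LP 0 (PowerSeries.C a) (fun _ => algebraMap K ℂ a) := by
  refine ⟨_, by rw [PowerSeries.map_C]; exact prep_C _, ?_⟩
  exact Eventually.of_forall fun τ => by simp

lemma LP.pow {k : ℕ} {p : PowerSeries K} {f : ℍ → ℂ} (h : LP k p f) (n : ℕ) :
    LP (k * n) (p ^ n) (fun τ => f τ ^ n) := by
  induction n with
  | zero => simpa using LP.const (1 : K)
  | succ n ih =>
    simp only [pow_succ, mul_add, mul_one]
    exact ih.mul h

lemma LP.shift {k : ℕ} {p : PowerSeries K} {f : ℍ → ℂ} (h : LP k p f) (j : ℕ) :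
    LP (k + j) (p * PowerSeries.X ^ j) f := by
  obtain ⟨F, hF, eF⟩ := h
  refine ⟨_, by rw [map_mul, map_pow, PowerSeries.map_X]; exact hF.mul (prep_X.pow j), ?_⟩
  filter_upwards [eF] with τ h1
  rw [← h1]; ring

lemma LP.unshift {k : ℕ} {p : PowerSeries K} {f : ℍ → ℂ} (h : LP (k + 1) (PowerSeries.X * p) f) : LP k p f := by
  obtain ⟨F, hF, eF⟩ := h
  rw [map_mul, PowerSeries.map_X] at hF
  obtain ⟨G, hG, e⟩ := hF.divX
  refine ⟨G, hG, ?_⟩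
  filter_upwards [eF] with τ h1
  rw [e _ (QQ_ne τ)] at h1
  have := QQ_ne τ
  rw [pow_succ'] at h1
  exact mul_left_cancel₀ this (by rw [← h1]; ring)

lemma LP.inv0 {p : PowerSeries K} {f : ℍ → ℂ} (h : LP 0 p f) (hp : PowerSeries.constantCoeff p ≠ 0) :
    LP 0 p⁻¹ (fun τ => (f τ)⁻¹) := by
  obtain ⟨F, hF, eF⟩ := h
  refine ⟨_, hF.inv (q := p⁻¹.map (algebraMap K ℂ)) (by rw [← map_mul, PowerSeries.mul_inv_cancel p hp, map_one]), ?_⟩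
  filter_upwards [eF] with τ h1
  rw [← h1]; simp

variable (K) in
/-- finite-tailed expansion with coefficients in `K` -/
def LEx (f : ℍ → ℂ) : Prop := ∃ (k : ℕ) (p : PowerSeries K), LP k p f

lemma LEx.mul {f g : ℍ → ℂ} (h : LEx K f) (h' : LEx K g) : LEx K (fun τ => f τ * g τ) := by
  obtain ⟨k, p, h⟩ := h
  obtain ⟨l, q, h'⟩ := h'
  exact ⟨_, _, h.mul h'⟩

lemma LEx.add {f g : ℍ → ℂ} (h : LEx K f) (h' : LEx K g) : LEx K (fun τ => f τ + g τ) := by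
  obtain ⟨k, p, h⟩ := h
  obtain ⟨l, q, h'⟩ := h'
  have h1 := h.shift l
  have h2 := h'.shift k
  rw [add_comm l k] at h2
  exact ⟨_, _, h1.add h2⟩

lemma LEx.const (a : K) : LEx K (fun _ => algebraMap K ℂ a) := ⟨_, _, LP.const a⟩

lemma LEx.pow {f : ℍ → ℂ} (h : LEx K f) (n : ℕ) : LEx K (fun τ => f τ ^ n) := by
  obtain ⟨k, p, h⟩ := h
  exact ⟨_, _, h.pow n⟩

lemma LEx.congr {f g : ℍ → ℂ} (h : LEx K f) (e : ∀ τ, g τ = f τ) : LEx K g := by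
  rwa [show g = f from funext e]

lemma LEx.ofQQ : LEx K QQ := by
  refine ⟨0, PowerSeries.X, _, by rw [PowerSeries.map_X]; exact prep_X, ?_⟩
  exact Eventually.of_forall fun τ => by simp

lemma LP.inv {m : ℕ} : ∀ {k : ℕ} {u : PowerSeries K} {f : ℍ → ℂ}, LP k (PowerSeries.X ^ m * u) f →
    PowerSeries.constantCoeff u ≠ 0 → LEx K (fun τ => (f τ)⁻¹) := by
  induction m with
  | zero =>
    intro k u f h hu
    have h1 : LP 0 u (fun τ => QQ τ ^ k * f τ) := by
      obtain ⟨F, hF, eF⟩ := h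
      refine ⟨F, by simpa using hF, ?_⟩
      filter_upwards [eF] with τ h1
      rw [← h1]; simp
    have h2 : LEx K _ := ⟨_, _, h1.inv0 hu⟩
    refine (h2.mul (LEx.ofQQ.pow k)).congr fun τ => ?_
    have := QQ_ne τ
    field_simp
  | succ m ih =>
    intro k u f h hu
    have h1 := h.shift 1
    rw [show PowerSeries.X ^ (m + 1) * u * PowerSeries.X ^ 1 = PowerSeries.X * (PowerSeries.X ^ m * u * PowerSeries.X) by ring] at h1
    have h2 := h1.unshift
    have h3 : LP k (PowerSeries.X ^ m * u) (fun τ => f τ * (QQ τ)⁻¹) := by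
      obtain ⟨F, hF, eF⟩ := h2
      rw [mul_comm, map_mul, PowerSeries.map_X] at hF
      obtain ⟨G, hG, e⟩ := hF.divX
      refine ⟨G, hG, ?_⟩
      filter_upwards [eF] with τ h1
      rw [e _ (QQ_ne τ)] at h1
      have := QQ_ne τ
      rw [← mul_assoc, h1]; field_simp
    have h4 : LEx K (fun τ => (QQ τ)⁻¹) := by
      refine ⟨1, 1, fun _ => 1, by simpa using prep_C 1, Eventually.of_forall fun τ => ?_⟩
      have := QQ_ne τ
      simp [this]
    refine ((ih h3 hu).mul h4).congr fun τ => ?_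
    have := QQ_ne τ
    field_simp

lemma LEx.inv {f : ℍ → ℂ} (h : LEx K f) : LEx K (fun τ => (f τ)⁻¹) := by
  obtain ⟨k, p, h⟩ := h
  by_cases hp : p = 0
  · obtain ⟨F, hF, eF⟩ := h
    refine ⟨k, p, F, hF, ?_⟩
    rw [hp, map_zero] at hF
    have h0 : ∀ᶠ z in 𝓝 0, F z = 0 := by
      filter_upwards [hF] with z hz
      simp only [map_zero, zero_mul] at hz
      exact hz.unique hasSum_zero
    filter_upwards [eF, QQ_tendsto.eventually h0] with τ h1 h2
    rw [h2] at h1 ⊢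
    have h3 := pow_ne_zero k (QQ_ne τ)
    have : f τ = 0 := by
      rcases mul_eq_zero.mp h1 with h | h
      · exact absurd h h3
      · exact h
    simp [this]
  · have hu := PowerSeries.X_pow_order_mul_divXPowOrder (f := p)
    rw [← hu] at h
    refine h.inv ?_
    rwa [ne_eq, PowerSeries.constantCoeff_divXPowOrder_eq_zero_iff]

end LEsec
end

section
open Filter Topology

section gexp
variable {K : Type} [Field K] [Algebra K ℂ]

lemma LEx.of_gexp {h : ℍ → ℂ} (n₀ : ℤ) (c : ℤ → K) (A : ℝ)
    (hh : ∀ τ : ℍ, A < τ.im → h τ = ∑' n : ℕ, algebraMap K ℂ (c (n₀ + (n : ℤ))) * QQ τ ^ (n₀ + (n : ℤ))) :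
    LEx K h := by
  have hA : ∀ᶠ τ : ℍ in atImInfty, A < τ.im :=
    (tendsto_comap (f := UpperHalfPlane.im) (x := atTop)).eventually (eventually_gt_atTop A)
  by_cases hs : ∃ τ₀ : ℍ, A < τ₀.im ∧ Summable (fun n : ℕ => algebraMap K ℂ (c (n₀ + (n : ℤ))) * QQ τ₀ ^ (n₀ + (n : ℤ)))
  · obtain ⟨τ₀, h0, hs⟩ := hs
    have hs1 : Summable (fun n : ℕ => algebraMap K ℂ (c (n₀ + (n : ℤ))) * QQ τ₀ ^ n) := by
      refine (hs.mul_left ((QQ τ₀ ^ n₀)⁻¹)).congr fun n => ?_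
      have := zpow_ne_zero n₀ (QQ_ne τ₀)
      rw [zpow_add₀ (QQ_ne τ₀), zpow_natCast]
      field_simp
    have hP : PRep ((PowerSeries.mk fun n : ℕ => c (n₀ + (n : ℤ))).map (algebraMap K ℂ))
        (fun z => ∑' n : ℕ, algebraMap K ℂ (c (n₀ + (n : ℤ))) * z ^ n) := by
      have : ∀ᶠ z : ℂ in 𝓝 0, ‖z‖ < ‖QQ τ₀‖ := by
        have := norm_pos_iff.mpr (QQ_ne τ₀)
        filter_upwards [Metric.ball_mem_nhds (0 : ℂ) this] with z hz
        simpa using hz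
      filter_upwards [this] with z hz
      have := summable_powerSeries_of_norm_lt hs1.hasSum.tendsto_sum_nat.cauchySeq hz
      simpa using this.hasSum
    obtain ⟨j, k, e⟩ : ∃ j k : ℕ, n₀ = j - k := ⟨n₀.toNat, (-n₀).toNat, by omega⟩
    have hP2 := hP.mul (prep_X.pow j)
    rw [← PowerSeries.map_X (algebraMap K ℂ), ← map_pow, ← map_mul] at hP2
    refine ⟨k, _, _, hP2, ?_⟩
    filter_upwards [hA] with τ hτ
    rw [hh τ hτ, ← tsum_mul_left, ← tsum_mul_right]
    refine tsum_congr fun n => ?_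
    have := pow_ne_zero k (QQ_ne τ)
    rw [zpow_add₀ (QQ_ne τ), e, zpow_sub₀ (QQ_ne τ), zpow_natCast, zpow_natCast, zpow_natCast]
    field_simp
  · refine ⟨0, 0, fun _ => 0, by simpa using prep_C 0, ?_⟩
    filter_upwards [hA] with τ hτ
    rw [hh τ hτ, tsum_eq_zero_of_not_summable, mul_zero]
    exact fun h => hs ⟨τ, hτ, h⟩

lemma LEx.to_gexp {h : ℍ → ℂ} (H : LEx K h) : ∃ (n₀ : ℤ) (c : ℤ → K) (A : ℝ),
    ∀ τ : ℍ, A < τ.im → h τ = ∑' n : ℕ, algebraMap K ℂ (c (n₀ + (n : ℤ))) * QQ τ ^ (n₀ + (n : ℤ)) := by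
  obtain ⟨k, p, F, hF, e⟩ := H
  have e2 := e.and (QQ_tendsto.eventually hF)
  obtain ⟨A, hA⟩ := (UpperHalfPlane.atImInfty_mem _).mp e2
  refine ⟨-k, fun m => PowerSeries.coeff (m + k).toNat p, A, fun τ hτ => ?_⟩
  obtain ⟨h1, h2⟩ := hA τ hτ.le
  have hk := pow_ne_zero k (QQ_ne τ)
  have h3 := (h2.mul_left (QQ τ ^ k)⁻¹).tsum_eq
  rw [← h1] at h3
  rw [show h τ = (QQ τ ^ k)⁻¹ * (QQ τ ^ k * h τ) by field_simp, ← h3]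
  refine tsum_congr fun n => ?_
  rw [zpow_add₀ (QQ_ne τ), _root_.zpow_neg, zpow_natCast, zpow_natCast, PowerSeries.coeff_map]
  have h5 : (-(k : ℤ) + n + k).toNat = n := by omega
  simp only [h5]
  ring
end gexp

lemma qpow_four (τ : ℍ) (m : ℤ) : qpow τ ((m : ℂ) / ((4 : ℕ) : ℂ)) = QQ τ ^ m :=
  qpow_int τ m _ (by norm_num)

lemma ratQ_iff (h : ℍ → ℂ) : RatQExp 4 h ↔ LEx ℚ h := by
  unfold RatQExp
  simp only [qpow_four]
  constructor
  · rintro ⟨n₀, c, A, H⟩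
    exact LEx.of_gexp n₀ c A H
  · exact fun H => H.to_gexp

lemma cusp_iff (h : ℍ → ℂ) : CuspExp 4 h ↔ LEx ℂ h := by
  unfold CuspExp
  simp only [qpow_four]
  constructor
  · rintro ⟨n₀, c, A, H⟩
    exact LEx.of_gexp n₀ c A H
  · exact fun H => H.to_gexp

/-- regrouping -/
lemma prep_regroup {ι : Type} (e : ι → ℕ) (hs : ∀ z : ℂ, ‖z‖ < 1 → Summable fun i => z ^ e i) :
    PRep ((PowerSeries.mk fun n => (Nat.card {i // e i = n} : ℚ)).map (algebraMap ℚ ℂ)) (fun z => ∑' i, z ^ e i) := by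
  have : ∀ᶠ z : ℂ in 𝓝 0, ‖z‖ < 1 := by
    filter_upwards [Metric.ball_mem_nhds (0 : ℂ) one_pos] with z hz
    simpa using hz
  filter_upwards [this] with z hz
  have h1 := (hs z hz).hasSum
  have h2 := (Equiv.hasSum_iff (Equiv.sigmaFiberEquiv e)).mpr h1
  have h3 := h2.sigma (fun n => (h2.summable.sigma_factor n).hasSum)
  refine h3.congr_fun fun n => ?_
  have h4 : ∀ c : {i // e i = n}, ((fun i => z ^ e i) ∘ ⇑(Equiv.sigmaFiberEquiv e)) ⟨n, c⟩ = z ^ n := by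
    rintro ⟨i, hi⟩
    simp [Equiv.sigmaFiberEquiv, hi]
  simp only [h4]
  rw [tsum_const]
  simp
end

section
open Filter Topology

/-- coefficients of theta -/
def pth : PowerSeries ℚ := PowerSeries.mk fun n => (Nat.card {i : ℤ // i.natAbs ^ 2 = n} : ℚ)
/-- coefficients of psi -/
def pps : PowerSeries ℚ := PowerSeries.mk fun n => (Nat.card {i : ℤ // (i * (i + 1)).natAbs = n} : ℚ)

lemma prep_th : PRep (pth.map (algebraMap ℚ ℂ)) th3 :=
  prep_regroup (fun i : ℤ => i.natAbs ^ 2) (fun _ hz => th3_summable hz)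

lemma prep_ps : PRep (pps.map (algebraMap ℚ ℂ)) ps :=
  prep_regroup (fun i : ℤ => (i * (i + 1)).natAbs) (fun _ hz => ps_summable hz)

lemma th3_zero : th3 0 = 1 := by
  unfold th3
  rw [tsum_eq_single 0]
  · simp
  · intro n hn; simp [hn]

lemma ps_zero : ps 0 = 2 := by
  unfold ps
  rw [tsum_eq_sum (s := {0, -1})]
  · rw [Finset.sum_pair (by norm_num)]; norm_num
  · intro n hn
    simp only [Finset.mem_insert, Finset.mem_singleton, not_or] at hn
    apply zero_pow
    rw [Int.natAbs_ne_zero]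
    exact mul_ne_zero hn.1 (by omega)

lemma cc_th : PowerSeries.constantCoeff pth = 1 := by
  have h := prep_th.at_zero
  rw [th3_zero, ← PowerSeries.coeff_zero_eq_constantCoeff_apply, PowerSeries.coeff_map,
    PowerSeries.coeff_zero_eq_constantCoeff_apply] at h
  have h2 : ((PowerSeries.constantCoeff pth : ℚ) : ℂ) = ((1 : ℚ) : ℂ) := by
    simpa using h.symm
  exact_mod_cast h2

lemma cc_ps : PowerSeries.constantCoeff pps = 2 := by
  have h := prep_ps.at_zero
  rw [ps_zero, ← PowerSeries.coeff_zero_eq_constantCoeff_apply, PowerSeries.coeff_map,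
    PowerSeries.coeff_zero_eq_constantCoeff_apply] at h
  have h2 : ((PowerSeries.constantCoeff pps : ℚ) : ℂ) = ((2 : ℚ) : ℂ) := by
    simpa using h.symm
  exact_mod_cast h2

lemma LP.ofPRep {K : Type} [Field K] [Algebra K ℂ] {p : PowerSeries K} {F : ℂ → ℂ}
    (h : PRep (p.map (algebraMap K ℂ)) F) : LP 0 p (fun τ => F (QQ τ)) :=
  ⟨F, h, Eventually.of_forall fun τ => by simp⟩

/-- expansion of g -/
def pgg : PowerSeries ℚ := PowerSeries.C 16 * (pth * pps⁻¹) ^ 4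

lemma LP_g : LP 1 pgg g14slash := by
  have h1 := LP.ofPRep prep_th
  have h2 := (LP.ofPRep prep_ps).inv0 (by rw [cc_ps]; norm_num)
  obtain ⟨F, hF, e⟩ := (LP.const (16 : ℚ)).mul ((h1.mul h2).pow 4)
  refine ⟨F, hF, ?_⟩
  filter_upwards [e] with τ hτ
  rw [← hτ, g_theta]
  have := QQ_ne τ
  simp [div_eq_mul_inv]
  field_simp

lemma cc_g : PowerSeries.constantCoeff pgg = 1 := by
  unfold pgg
  rw [map_mul, map_pow, map_mul, PowerSeries.constantCoeff_inv, cc_th, cc_ps, PowerSeries.constantCoeff_C]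
  norm_num

lemma LEx_g : LEx ℚ g14slash := ⟨_, _, LP_g⟩

lemma mapid (p : PowerSeries ℂ) : p.map (algebraMap ℂ ℂ) = p := by
  ext n; simp

lemma LEx.toC {f : ℍ → ℂ} (h : LEx ℚ f) : LEx ℂ f := by
  obtain ⟨k, p, F, hF, e⟩ := h
  exact ⟨k, p.map (algebraMap ℚ ℂ), F, by rwa [mapid], e⟩

lemma prep_th2 : ∃ p : PowerSeries ℂ, PRep p (fun z => th3 (z ^ 2)) := by
  refine ⟨_, (prep_regroup (fun i : ℤ => 2 * i.natAbs ^ 2) (fun z hz => ?_)).congr ?_⟩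
  · simp only [pow_mul]
    simpa only [pow_mul] using th3_summable (sq_lt hz)
  · refine Eventually.of_forall fun z => ?_
    simp only [pow_mul, th3]

lemma prep_ps2 : ∃ p : PowerSeries ℂ, PRep p (fun z => ps (z ^ 2)) := by
  refine ⟨_, (prep_regroup (fun i : ℤ => 2 * (i * (i + 1)).natAbs) (fun z hz => ?_)).congr ?_⟩
  · simpa only [pow_mul] using ps_summable (sq_lt hz)
  · refine Eventually.of_forall fun z => ?_
    simp only [pow_mul, ps]

lemma prep_th2n : ∃ p : PowerSeries ℂ, PRep p (fun z => th3 (-z ^ 2)) := by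
  obtain ⟨p, hp⟩ := prep_th2
  refine ⟨_, (hp.rescale Complex.I).congr ?_⟩
  exact Eventually.of_forall fun z => by simp [mul_pow]

lemma LEx.ofP {F : ℂ → ℂ} (h : ∃ p : PowerSeries ℂ, PRep p F) : LEx ℂ (fun τ => F (QQ τ)) := by
  obtain ⟨p, hp⟩ := h
  exact ⟨0, p, LP.ofPRep (by rwa [mapid])⟩

lemma LEx_xx : LEx ℂ xx := by
  refine ((LEx.ofQQ.mul ((LEx.ofP prep_ps2).pow 2)).mul (((LEx.ofP prep_th2).pow 2).inv)).congr fun τ => ?_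
  simp only [xx, div_eq_mul_inv]

lemma LEx_yy : LEx ℂ yy := by
  refine ((((LEx.ofP prep_th2n).pow 2)).mul (((LEx.ofP prep_th2).pow 2).inv)).congr fun τ => ?_
  simp only [yy, div_eq_mul_inv]

lemma LEx.smulC {f : ℍ → ℂ} (h : LEx ℂ f) (a : ℂ) : LEx ℂ (fun τ => a * f τ) :=
  (LEx.const (K := ℂ) a).mul h

lemma LEx.phi {f : ℍ → ℂ} (h : LEx ℂ f) : LEx ℂ (fun τ => phi (f τ)) := by
  refine (((((LEx.const (K := ℂ) 1).add h).pow 2).smulC 4).mul h.inv).congr fun τ => ?_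
  simp [_root_.phi, div_eq_mul_inv]

lemma LEx_uTab (i : Fin 6) : LEx ℂ (fun τ => uTab i (xx τ) (yy τ)) := by
  have h1 := (LEx_xx.mul LEx_yy.inv).smulC Complex.I
  fin_cases i
  · exact LEx_xx
  · exact h1
  · exact (LEx_xx.smulC (-1)).congr fun τ => by simp [uTab]
  · exact (h1.smulC (-1)).congr fun τ => by simp [uTab, div_eq_mul_inv]
  · exact LEx_yy
  · exact (LEx_yy.smulC (-1)).congr fun τ => by simp [uTab]

lemma LEx_g_orbit (σ : SL2Z) : LEx ℂ (fun τ => g14slash (σ • τ)) :=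
  (LEx_uTab (mIdx σ)).phi.congr fun τ => g_orbit σ τ

lemma LP.bdd {K : Type} [Field K] [Algebra K ℂ] {k : ℕ} {p : PowerSeries K} {f : ℍ → ℂ} (h : LP k p f) :
    (fun τ => QQ τ ^ k * f τ) =O[atImInfty] (fun _ => (1 : ℝ)) := by
  obtain ⟨F, hF, e⟩ := h
  have h1 : AnalyticAt ℂ F 0 := ⟨_, hF.hasF⟩
  have h2 := (h1.continuousAt.tendsto.comp QQ_tendsto).isBigO_one ℝ
  exact h2.congr' (by filter_upwards [e] with τ hτ; simp [hτ]) (by rfl)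

lemma yy_bigO : (fun τ => 16 * (1 - yy τ ^ 2) ^ 2 / yy τ ^ 2) =O[atImInfty] QQ := by
  obtain ⟨p, hp⟩ := prep_th2n
  obtain ⟨q, hq⟩ := prep_th2
  have a1 : AnalyticAt ℂ (fun z => th3 (-z ^ 2)) (0 : ℂ) := ⟨_, hp.hasF⟩
  have a2 : AnalyticAt ℂ (fun z => th3 (z ^ 2)) (0 : ℂ) := ⟨_, hq.hasF⟩
  have n1 : th3 (-(0:ℂ) ^ 2) ≠ 0 := by simp [th3_zero]
  have n2 : th3 ((0:ℂ) ^ 2) ≠ 0 := by simp [th3_zero]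
  have a3 : AnalyticAt ℂ (fun z => th3 (-z ^ 2) ^ 2 / th3 (z ^ 2) ^ 2) 0 :=
    (a1.pow 2).div (a2.pow 2) (pow_ne_zero 2 n2)
  have a4 : AnalyticAt ℂ (fun z => 16 * (1 - (th3 (-z ^ 2) ^ 2 / th3 (z ^ 2) ^ 2) ^ 2) ^ 2 / (th3 (-z ^ 2) ^ 2 / th3 (z ^ 2) ^ 2) ^ 2) 0 := by
    refine AnalyticAt.div (analyticAt_const.mul ((analyticAt_const.sub (a3.pow 2)).pow 2)) (a3.pow 2) ?_
    simp [th3_zero]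
  have h := a4.differentiableAt.isBigO_sub.comp_tendsto QQ_tendsto
  refine h.congr (fun τ => ?_) (fun τ => ?_)
  · simp [th3_zero, yy]
  · simp
end

section
open Filter Topology

lemma isOpen_uh : IsOpen {z : ℂ | 0 < z.im} := isOpen_lt continuous_const Complex.continuous_im

lemma acf_apply (h : ℍ → ℂ) (z : ℂ) (hz : 0 < z.im) : asComplexFun h z = h ⟨z, hz⟩ := by
  simp [asComplexFun, hz]

lemma holo_mul {f g : ℍ → ℂ} (hf : IsHoloOnH f) (hg : IsHoloOnH g) : IsHoloOnH (fun τ => f τ * g τ) := by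
  refine (DifferentiableOn.mul hf hg).congr fun z hz => ?_
  simp only [Set.mem_setOf_eq] at hz
  simp [acf_apply _ z hz]

lemma holo_add {f g : ℍ → ℂ} (hf : IsHoloOnH f) (hg : IsHoloOnH g) : IsHoloOnH (fun τ => f τ + g τ) := by
  refine (DifferentiableOn.add hf hg).congr fun z hz => ?_
  simp only [Set.mem_setOf_eq] at hz
  simp [acf_apply _ z hz]

lemma holo_const (a : ℂ) : IsHoloOnH (fun _ => a) := by
  refine (differentiableOn_const a).congr fun z hz => ?_
  simp only [Set.mem_setOf_eq] at hz
  simp [acf_apply _ z hz]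

lemma holo_inv {f : ℍ → ℂ} (hf : IsHoloOnH f) (h0 : ∀ τ, f τ ≠ 0) : IsHoloOnH (fun τ => (f τ)⁻¹) := by
  refine (DifferentiableOn.inv hf (fun z hz => ?_)).congr fun z hz => ?_
  · simp only [Set.mem_setOf_eq] at hz
    rw [acf_apply _ z hz]; exact h0 _
  · simp only [Set.mem_setOf_eq] at hz
    simp [acf_apply _ z hz]

lemma holo_pow {f : ℍ → ℂ} (hf : IsHoloOnH f) (n : ℕ) : IsHoloOnH (fun τ => f τ ^ n) := by
  refine (DifferentiableOn.pow hf n).congr fun z hz => ?_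
  simp only [Set.mem_setOf_eq] at hz
  simp [acf_apply _ z hz]

lemma merom_of_holo {f : ℍ → ℂ} (hf : IsHoloOnH f) : IsMeromOnH f := fun z hz =>
  (DifferentiableOn.analyticOnNhd hf isOpen_uh z hz).meromorphicAt

lemma diff_regroup (e : ℤ → ℕ) (hs : ∀ z : ℂ, ‖z‖ < 1 → Summable fun i => z ^ e i) {z : ℂ} (hz : ‖z‖ < 1) :
    DifferentiableAt ℂ (fun z => ∑' i, z ^ e i) z := by
  obtain ⟨r, h1, h2⟩ := exists_between hz
  have hr : 0 ≤ r := (norm_nonneg z).trans h1.le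
  have hb : z ∈ Metric.ball (0 : ℂ) r := by simpa using h1
  refine (differentiableOn_tsum_of_summable_norm (u := fun i => r ^ e i) ?_ ?_ Metric.isOpen_ball ?_).differentiableAt
    (Metric.isOpen_ball.mem_nhds hb)
  · have := (hs (r : ℂ) (by simpa [abs_of_nonneg hr] using h2)).norm
    simpa [abs_of_nonneg hr] using this
  · intro i; fun_prop
  · intro i w hw
    rw [norm_pow]
    have : ‖w‖ < r := by simpa using hw
    gcongr

lemma holo_g : IsHoloOnH g14slash := by
  intro z hz
  have hz' : 0 < z.im := hz
  refine DifferentiableAt.differentiableWithinAt ?_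
  have hQ : ∀ τ : ℍ, QQ τ = cexp (2 * Real.pi * Complex.I * (1 / 4) * τ) := fun τ => rfl
  have e : asComplexFun g14slash =ᶠ[𝓝 z] fun w =>
      16 * (cexp (2 * Real.pi * Complex.I * (1 / 4) * w))⁻¹ *
        (th3 (cexp (2 * Real.pi * Complex.I * (1 / 4) * w)) / ps (cexp (2 * Real.pi * Complex.I * (1 / 4) * w))) ^ 4 := by
    filter_upwards [isOpen_uh.mem_nhds hz] with w hw
    have hw' : 0 < w.im := hw
    rw [acf_apply _ w hw', g_theta, hQ]
  refine DifferentiableAt.congr_of_eventuallyEq ?_ e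
  have h1 : DifferentiableAt ℂ (fun w : ℂ => cexp (2 * Real.pi * Complex.I * (1 / 4) * w)) z := by fun_prop
  have hlt : ‖cexp (2 * Real.pi * Complex.I * (1 / 4) * z)‖ < 1 := QQ_lt ⟨z, hz'⟩
  have h2 := (diff_regroup (fun i : ℤ => i.natAbs ^ 2) (fun _ hz => th3_summable hz) hlt).comp z h1
  have h3 := (diff_regroup (fun i : ℤ => (i * (i + 1)).natAbs) (fun _ hz => ps_summable hz) hlt).comp z h1
  exact (h1.inv (Complex.exp_ne_zero _)).const_mul 16 |>.mul
    ((h2.div h3 (ps_ne hlt (Complex.exp_ne_zero _))).pow 4)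

/-- the working version of the ring -/
structure Good (h : ℍ → ℂ) : Prop where
  holo : IsHoloOnH h
  modular : ∀ γ : SL2Z, InGamma1Lower 4 γ → ∀ τ : ℍ, h (γ • τ) = h τ
  cusp : ∀ γ : SL2Z, LEx ℂ (fun τ => h (γ • τ))
  ratQ : LEx ℚ h

lemma good_iff (h : ℍ → ℂ) : MemO1N 4 h ↔ Good h := by
  constructor
  · rintro ⟨⟨h1, h2, h3, h4⟩, h5⟩
    exact ⟨h5, h2, fun γ => (cusp_iff _).mp (h3 γ), (ratQ_iff _).mp h4⟩
  · rintro ⟨h1, h2, h3, h4⟩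
    exact ⟨⟨merom_of_holo h1, h2, fun γ => (cusp_iff _).mpr (h3 γ), (ratQ_iff _).mpr h4⟩, h1⟩

lemma Good.mul {f g : ℍ → ℂ} (hf : Good f) (hg : Good g) : Good (fun τ => f τ * g τ) :=
  ⟨holo_mul hf.1 hg.1, fun γ h τ => by rw [hf.2 γ h, hg.2 γ h], fun γ => (hf.3 γ).mul (hg.3 γ), hf.4.mul hg.4⟩

lemma Good.add {f g : ℍ → ℂ} (hf : Good f) (hg : Good g) : Good (fun τ => f τ + g τ) :=
  ⟨holo_add hf.1 hg.1, fun γ h τ => by rw [hf.2 γ h, hg.2 γ h], fun γ => (hf.3 γ).add (hg.3 γ), hf.4.add hg.4⟩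

lemma Good.inv {f : ℍ → ℂ} (hf : Good f) (h0 : ∀ τ, f τ ≠ 0) : Good (fun τ => (f τ)⁻¹) :=
  ⟨holo_inv hf.1 h0, fun γ h τ => by rw [hf.2 γ h], fun γ => (hf.3 γ).inv, hf.4.inv⟩

lemma good_const (a : ℚ) : Good (fun _ => algebraMap ℚ ℂ a) :=
  ⟨holo_const _, fun _ _ _ => rfl, fun _ => LEx.const (K := ℂ) _, LEx.const a⟩

lemma good_g : Good g14slash := ⟨holo_g, g_modular, LEx_g_orbit, LEx_g⟩

lemma good_g16 : Good (fun τ => g14slash τ - 16) := by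
  have := good_g.add (good_const (-16))
  simpa [sub_eq_add_neg] using this

lemma Good.pow {f : ℍ → ℂ} (hf : Good f) (n : ℕ) : Good (fun τ => f τ ^ n) := by
  induction n with
  | zero => simpa using good_const 1
  | succ n ih => simp only [pow_succ]; exact ih.mul hf

lemma good_poly (P : MvPolynomial (Fin 3) ℚ) :
    Good fun τ => MvPolynomial.aeval ![g14slash τ, (g14slash τ)⁻¹, (g14slash τ - 16)⁻¹] P := by
  induction P using MvPolynomial.induction_on with
  | C a => simp only [MvPolynomial.aeval_C]; exact good_const a
  | add p q hp hq => simp only [map_add]; exact hp.add hq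
  | mul_X p i hp =>
    simp only [map_mul, MvPolynomial.aeval_X]
    refine hp.mul ?_
    fin_cases i
    · exact good_g
    · exact good_g.inv g_ne
    · exact good_g16.inv g_sub_ne
end

section
open Filter Topology
open scoped ModularForm

lemma liouville {f : ℍ → ℂ} (h1 : IsHoloOnH f)
    (h2 : ∀ γ : SL2Z, InGamma1Lower 4 γ → ∀ τ : ℍ, f (γ • τ) = f τ)
    (h3 : ∀ γ : SL2Z, (fun τ : ℍ => f (γ • τ)) =O[atImInfty] (fun _ => (1 : ℝ))) :
    ∃ c, ∀ τ, f τ = c := by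
  let F : ModularForm ((CongruenceSubgroup.Gamma 4).map (Matrix.SpecialLinearGroup.mapGL ℝ)) 0 :=
    { toFun := f
      slash_action_eq' := by
        rintro γ ⟨σ, hσ, rfl⟩
        have hm := (CongruenceSubgroup.Gamma_mem (N := 4)).mp hσ
        ext τ
        have := ModularForm.SL_slash_apply (k := 0) f σ τ
        have e := h2 σ ⟨hm.1, hm.2.1, hm.2.2.2⟩ τ
        simp only [neg_zero, zpow_zero, mul_one] at this
        rw [e] at this
        exact this
      holo' := by
        rw [UpperHalfPlane.mdifferentiable_iff]
        refine DifferentiableOn.congr h1 fun z hz => ?_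
        have hz' : 0 < z.im := hz
        rw [acf_apply _ z hz', Function.comp_apply, UpperHalfPlane.ofComplex_apply_of_im_pos hz']
        rfl
      bdd_at_cusps' := by
        intro c hc
        rw [Subgroup.IsArithmetic.isCusp_iff_isCusp_SL2Z] at hc
        rw [OnePoint.isBoundedAt_iff_forall_SL2Z hc]
        intro γ _
        have : f ∣[(0 : ℤ)] γ = fun τ => f (γ • τ) := by
          ext τ
          rw [ModularForm.SL_slash_apply]
          simp
        rw [this]
        exact h3 γ }
  obtain ⟨c, hc⟩ := ModularForm.eq_const_of_weight_zero F
  exact ⟨c, fun τ => congrFun hc τ⟩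

lemma row_eq {f : ℍ → ℂ} (h2 : ∀ γ : SL2Z, InGamma1Lower 4 γ → ∀ τ : ℍ, f (γ • τ) = f τ)
    (γ σ : SL2Z) (ha : ((γ 0 0 : ℤ) : ZMod 4) = ((σ 0 0 : ℤ) : ZMod 4))
    (hb : ((γ 0 1 : ℤ) : ZMod 4) = ((σ 0 1 : ℤ) : ZMod 4)) (τ : ℍ) : f (γ • τ) = f (σ • τ) := by
  have hd : ∀ ρ : SL2Z, ((ρ 0 0 : ℤ) : ZMod 4) * ((ρ 1 1 : ℤ) : ZMod 4) - ((ρ 0 1 : ℤ) : ZMod 4) * ((ρ 1 0 : ℤ) : ZMod 4) = 1 := by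
    intro ρ
    have := ρ.det_coe
    rw [Matrix.det_fin_two] at this
    exact_mod_cast congrArg (Int.cast : ℤ → ZMod 4) this
  have hγ := hd γ
  have hσ := hd σ
  have i00 : (σ⁻¹ : SL2Z) 0 0 = σ 1 1 := by
    rw [Matrix.SpecialLinearGroup.SL2_inv_expl]; rfl
  have i01 : (σ⁻¹ : SL2Z) 0 1 = - σ 0 1 := by
    rw [Matrix.SpecialLinearGroup.SL2_inv_expl]; rfl
  have i10 : (σ⁻¹ : SL2Z) 1 0 = - σ 1 0 := by
    rw [Matrix.SpecialLinearGroup.SL2_inv_expl]; rfl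
  have i11 : (σ⁻¹ : SL2Z) 1 1 = σ 0 0 := by
    rw [Matrix.SpecialLinearGroup.SL2_inv_expl]; rfl
  have key : InGamma1Lower 4 (γ * σ⁻¹) := by
    refine ⟨?_, ?_, ?_⟩ <;> rw [mul_entry] <;> simp only [i00, i01, i10, i11] <;> push_cast
    · rw [ha, hb, ← hσ]; ring
    · rw [ha, hb]; ring
    · rw [← ha, ← hb, ← hγ]; ring
  have := h2 _ key (σ • τ)
  rw [← this, ← mul_smul, inv_mul_cancel_right]

lemma uniform_bdd {f : ℍ → ℂ} (h : Good f) :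
    ∃ m : ℕ, ∀ γ : SL2Z, (fun τ : ℍ => QQ τ ^ m * f (γ • τ)) =O[atImInfty] (fun _ => (1 : ℝ)) := by
  have key : ∀ r : ZMod 4 × ZMod 4, ∃ m : ℕ, ∀ γ : SL2Z, ((γ 0 0 : ℤ) : ZMod 4) = r.1 → ((γ 0 1 : ℤ) : ZMod 4) = r.2 →
      (fun τ : ℍ => QQ τ ^ m * f (γ • τ)) =O[atImInfty] (fun _ => (1 : ℝ)) := by
    intro r
    by_cases hr : ∃ γ : SL2Z, ((γ 0 0 : ℤ) : ZMod 4) = r.1 ∧ ((γ 0 1 : ℤ) : ZMod 4) = r.2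
    · obtain ⟨σ, h1, h2⟩ := hr
      obtain ⟨k, p, hp⟩ := h.cusp σ
      refine ⟨k, fun γ e1 e2 => ?_⟩
      simp only [row_eq h.modular γ σ (e1.trans h1.symm) (e2.trans h2.symm)]
      exact hp.bdd
    · exact ⟨0, fun γ e1 e2 => absurd ⟨γ, e1, e2⟩ hr⟩
  choose m hm using key
  refine ⟨∑ r, m r, fun γ => ?_⟩
  have h1 := hm (((γ 0 0 : ℤ) : ZMod 4), ((γ 0 1 : ℤ) : ZMod 4)) γ rfl rfl
  set r := (((γ 0 0 : ℤ) : ZMod 4), ((γ 0 1 : ℤ) : ZMod 4))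
  have hle : m r ≤ ∑ r, m r := Finset.single_le_sum (fun _ _ => Nat.zero_le _) (Finset.mem_univ r)
  have h2 : (fun τ : ℍ => QQ τ ^ (∑ r, m r) * f (γ • τ)) =O[atImInfty] fun τ : ℍ => QQ τ ^ (m r) * f (γ • τ) := by
    refine Asymptotics.IsBigO.of_bound 1 (Eventually.of_forall fun τ => ?_)
    rw [one_mul, norm_mul, norm_mul, norm_pow, norm_pow]
    have := pow_le_pow_of_le_one (norm_nonneg (QQ τ)) (QQ_lt τ).le hle
    gcongr
  exact h2.trans h1

lemma g_even (γ : SL2Z) (ha : ((γ 0 0 : ℤ) : ZMod 4) = 0 ∨ ((γ 0 0 : ℤ) : ZMod 4) = 2) (τ : ℍ) :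
    g14slash (γ • τ) * (g14slash (γ • τ) - 16) = 16 * (1 - yy τ ^ 2) ^ 2 / yy τ ^ 2 := by
  have hy := yy_ne τ
  rw [g_orbit]
  rcases ha with h | h
  · have : mIdx γ = 4 := by simp [mIdx, rIdx, h]
    rw [this]
    simp only [uTab, phi]
    field_simp
    ring
  · have : mIdx γ = 5 := by
      unfold mIdx rIdx
      rw [h, if_neg (by decide), if_pos rfl]
    rw [this]
    simp only [uTab, phi]
    field_simp
    ring

lemma g_even_bigO (γ : SL2Z) (ha : ((γ 0 0 : ℤ) : ZMod 4) = 0 ∨ ((γ 0 0 : ℤ) : ZMod 4) = 2) :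
    (fun τ => g14slash (γ • τ) * (g14slash (γ • τ) - 16)) =O[atImInfty] QQ :=
  yy_bigO.congr_left fun τ => (g_even γ ha τ).symm

lemma QQ_bigO : QQ =O[atImInfty] (fun _ => (1 : ℝ)) :=
  Asymptotics.IsBigO.of_bound 1 (Eventually.of_forall fun τ => by simpa using (QQ_lt τ).le)

lemma g_even_bdd (γ : SL2Z) (ha : ((γ 0 0 : ℤ) : ZMod 4) = 0 ∨ ((γ 0 0 : ℤ) : ZMod 4) = 2) :
    (fun τ : ℍ => g14slash (γ • τ)) =O[atImInfty] (fun _ => (1 : ℝ)) := by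
  obtain ⟨M, hM⟩ := ((g_even_bigO γ ha).trans QQ_bigO).bound
  refine Asymptotics.IsBigO.of_bound (17 + |M|) ?_
  filter_upwards [hM] with τ hτ
  rw [norm_mul] at hτ
  simp only [norm_one, mul_one] at hτ ⊢
  have h1 : ‖g14slash (γ • τ)‖ ≤ ‖g14slash (γ • τ) - 16‖ + 16 := by
    have := norm_add_le (g14slash (γ • τ) - 16) 16
    simpa using this
  by_contra hc
  push Not at hc
  have h2 := le_abs_self M
  have h3 := abs_nonneg M
  nlinarith [norm_nonneg (g14slash (γ • τ) - 16)]

lemma T_row (b : ℤ) : ((ModularGroup.T ^ b) 0 0 : ℤ) = 1 ∧ ((ModularGroup.T ^ b) 0 1 : ℤ) = b := by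
  rw [ModularGroup.coe_T_zpow]; simp

lemma tendsto_T (b : ℤ) : Tendsto (fun τ : ℍ => ModularGroup.T ^ b • τ) atImInfty atImInfty := by
  rw [atImInfty, tendsto_comap_iff]
  have : (UpperHalfPlane.im ∘ fun τ : ℍ => ModularGroup.T ^ b • τ) = UpperHalfPlane.im := by
    ext τ
    rw [Function.comp_apply, UpperHalfPlane.modular_T_zpow_smul]
    simp
  rw [this]
  exact tendsto_comap

lemma odd_bdd {f : ℍ → ℂ} (h2 : ∀ γ : SL2Z, InGamma1Lower 4 γ → ∀ τ : ℍ, f (γ • τ) = f τ)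
    (hf : f =O[atImInfty] (fun _ => (1 : ℝ))) (γ : SL2Z)
    (ha : ((γ 0 0 : ℤ) : ZMod 4) = 1 ∨ ((γ 0 0 : ℤ) : ZMod 4) = 3) :
    (fun τ : ℍ => f (γ • τ)) =O[atImInfty] (fun _ => (1 : ℝ)) := by
  rcases ha with ha | ha
  · have e : ∀ τ, f (γ • τ) = f (ModularGroup.T ^ (γ 0 1 : ℤ) • τ) := by
      apply row_eq h2
      · rw [ha, (T_row _).1]; simp
      · rw [(T_row _).2]
    simp only [e]
    exact hf.comp_tendsto (tendsto_T _)
  · have e : ∀ τ, f (γ • τ) = f (ModularGroup.T ^ (-(γ 0 1 : ℤ)) • τ) := by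
      intro τ
      rw [← ModularGroup.SL_neg_smul]
      apply row_eq h2
      · show ((-(γ 0 0) : ℤ) : ZMod 4) = _
        rw [(T_row _).1, Int.cast_neg, ha]; decide
      · show ((-(γ 0 1) : ℤ) : ZMod 4) = _
        rw [(T_row _).2]
    simp only [e]
    exact hf.comp_tendsto (tendsto_T _)

lemma main_induct (k : ℕ) : ∀ {f : ℍ → ℂ} (p : PowerSeries ℚ), IsHoloOnH f →
    (∀ γ : SL2Z, InGamma1Lower 4 γ → ∀ τ : ℍ, f (γ • τ) = f τ) →
    (∀ γ : SL2Z, (((γ 0 0 : ℤ) : ZMod 4) = 0 ∨ ((γ 0 0 : ℤ) : ZMod 4) = 2) →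
      (fun τ : ℍ => f (γ • τ)) =O[atImInfty] (fun _ => (1 : ℝ))) →
    LP k p f → ∃ P : Polynomial ℚ, ∀ τ, f τ = Polynomial.aeval (g14slash τ) P := by
  induction k with
  | zero =>
    intro f p h1 h2 h3 hp
    have hb : f =O[atImInfty] (fun _ => (1 : ℝ)) := by simpa using hp.bdd
    obtain ⟨c, hc⟩ := liouville h1 h2 (by
      intro γ
      have : ∀ a : ZMod 4, (a = 0 ∨ a = 2) ∨ (a = 1 ∨ a = 3) := by decide
      rcases this ((γ 0 0 : ℤ) : ZMod 4) with h | h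
      · exact h3 γ h
      · exact odd_bdd h2 hb γ h)
    refine ⟨Polynomial.C (PowerSeries.constantCoeff p), fun τ => ?_⟩
    obtain ⟨F, hF, e⟩ := hp
    have hFa : AnalyticAt ℂ F 0 := ⟨_, hF.hasF⟩
    have t1 := hFa.continuousAt.tendsto.comp QQ_tendsto
    have t2 : Tendsto (F ∘ QQ) atImInfty (𝓝 c) := by
      refine tendsto_const_nhds.congr' ?_
      filter_upwards [e] with τ hτ
      rw [Function.comp_apply, ← hτ, hc]; simp
    have := tendsto_nhds_unique t1 t2
    rw [hc, ← this, hF.at_zero, Polynomial.aeval_C]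
    rw [← PowerSeries.coeff_zero_eq_constantCoeff_apply, PowerSeries.coeff_map,
      PowerSeries.coeff_zero_eq_constantCoeff_apply]
  | succ k ih =>
    intro f p h1 h2 h3 hp
    set a := PowerSeries.constantCoeff p with ha
    have e1 := (LP.const (-a)).mul (LP_g.pow (k + 1))
    rw [zero_add, one_mul] at e1
    have e2 := hp.add e1
    have hc : PowerSeries.constantCoeff (p + PowerSeries.C (-a) * pgg ^ (k + 1)) = 0 := by
      rw [map_add, map_mul, map_pow, cc_g, PowerSeries.constantCoeff_C, ← ha]; ring
    obtain ⟨q, hq⟩ := PowerSeries.X_dvd_iff.mpr hc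
    rw [hq] at e2
    obtain ⟨P, hP⟩ := ih q
      (holo_add h1 (holo_mul (holo_const _) (holo_pow holo_g (k + 1))))
      (fun γ hγ τ => by rw [h2 γ hγ, g_modular γ hγ])
      (fun γ hγ => by
        refine (h3 γ hγ).add ?_
        have := ((g_even_bdd γ hγ).pow (k + 1)).const_mul_left (algebraMap ℚ ℂ (-a))
        simpa using this)
      e2.unshift
    refine ⟨P + Polynomial.C a * Polynomial.X ^ (k + 1), fun τ => ?_⟩
    rw [map_add, ← hP τ]
    simp

lemma converse {h : ℍ → ℂ} (H : Good h) : ∃ P : MvPolynomial (Fin 3) ℚ,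
      h = fun τ => MvPolynomial.aeval ![g14slash τ, (g14slash τ)⁻¹, (g14slash τ - 16)⁻¹] P := by
  obtain ⟨m, hm⟩ := uniform_bdd H
  have G1 := H.mul ((good_g.mul good_g16).pow m)
  obtain ⟨k, p, hp⟩ := G1.ratQ
  obtain ⟨P, hP⟩ := main_induct k p G1.holo G1.modular (fun γ hγ => by
    have e1 := (Asymptotics.isBigO_refl (fun τ : ℍ => h (γ • τ)) atImInfty).mul ((g_even_bigO γ hγ).pow m)
    refine e1.trans ((hm γ).congr_left fun τ => ?_)
    ring) hp
  refine ⟨Polynomial.aeval (MvPolynomial.X 0) P * MvPolynomial.X 1 ^ m * MvPolynomial.X 2 ^ m, funext fun τ => ?_⟩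
  have e := hP τ
  have n1 := g_ne τ
  have n2 := g_sub_ne τ
  rw [map_mul, map_mul, map_pow, map_pow, ← Polynomial.aeval_algHom_apply]
  simp only [MvPolynomial.aeval_X]
  show h τ = Polynomial.aeval (g14slash τ) P * (g14slash τ)⁻¹ ^ m * (g14slash τ - 16)⁻¹ ^ m
  rw [← e, mul_pow, inv_pow, inv_pow]
  have n3 := pow_ne_zero m n1
  have n4 := pow_ne_zero m n2
  field_simp
end

/-- `O¹_4(ℚ) = ℚ[g¹_4, (g¹_4)⁻¹, (g¹_4 - 16)⁻¹]`. -/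
theorem O14slash_eq_polynomial_ring (h : ℍ → ℂ) :
    MemO1N 4 h ↔ ∃ P : MvPolynomial (Fin 3) ℚ,
      h = fun τ => MvPolynomial.aeval ![g14slash τ, (g14slash τ)⁻¹, (g14slash τ - 16)⁻¹] P := by
  rw [good_iff]
  constructor
  · exact converse
  · rintro ⟨P, rfl⟩
    exact good_poly P

end
end

section
/- The elliptic modular function j induces a bijection from SL₂(ℤ)\ℍ onto ℂ (i.e. j is surjective onto ℂ and j(τ₁) = j(τ₂) if and only if τ₂ = γ(τ₁) for some γ ∈ SL₂(ℤ)), with j(ζ₃) = 0 and j(ζ₄) = 1728, where ζ₃ = e^{2πi/3} and ζ₄ = i. -/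
noncomputable section

open Complex Matrix UpperHalfPlane MatrixGroups

open Complex Matrix UpperHalfPlane MatrixGroups

open scoped Topology PeriodPair in
lemma lattice_le_of_G_eq (L M : PeriodPair) (h : ∀ k, 3 ≤ k → L.G k = M.G k) :
    L.lattice ≤ M.lattice := by
  have h0 : ∀ N : PeriodPair, N.weierstrassPExcept 0 0 = 0 := by
    intro N
    simp [PeriodPair.weierstrassPExcept]
  have hL := L.hasFPowerSeriesAt_weierstrassPExcept 0
  have hM := M.hasFPowerSeriesAt_weierstrassPExcept 0
  have hs : (fun i : ℕ ↦
      if i = 0 then L.weierstrassPExcept 0 0 else ((i:ℂ) + 1) * L.sumInvPow 0 (i + 2)) =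
      (fun i : ℕ ↦
      if i = 0 then M.weierstrassPExcept 0 0 else ((i:ℂ) + 1) * M.sumInvPow 0 (i + 2)) := by
    funext i
    split_ifs with hi
    · rw [h0, h0]
    · rw [PeriodPair.sumInvPow_zero, PeriodPair.sumInvPow_zero, h _ (by omega)]
  rw [hs] at hL
  have hev : L.weierstrassPExcept 0 =ᶠ[𝓝 0] M.weierstrassPExcept 0 := by
    filter_upwards [hL.eventually_hasSum_sub, hM.eventually_hasSum_sub] with z h1 h2
    exact h1.unique h2
  have hev2 : L.weierstrassP =ᶠ[𝓝 0] M.weierstrassP := by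
    filter_upwards [hev] with z hz
    have e1 := L.weierstrassPExcept_add 0 z
    have e2 := M.weierstrassPExcept_add 0 z
    rw [← e1, ← e2]
    simpa using hz
  have hmer : Meromorphic (L.weierstrassP - M.weierstrassP) :=
    L.meromorphic_weierstrassP.sub M.meromorphic_weierstrassP
  have htop0 : meromorphicOrderAt (L.weierstrassP - M.weierstrassP) 0 = ⊤ := by
    rw [meromorphicOrderAt_eq_top_iff]
    filter_upwards [hev2.filter_mono nhdsWithin_le_nhds] with z hz
    simp [hz]
  have htop : ∀ z, meromorphicOrderAt (L.weierstrassP - M.weierstrassP) z = ⊤ := by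
    intro z
    by_contra hne
    exact (MeromorphicOn.meromorphicOrderAt_ne_top_of_isPreconnected (U := Set.univ)
      (fun x _ => hmer x) isPreconnected_univ (Set.mem_univ z) (Set.mem_univ 0) hne) htop0
  intro l hl
  by_contra hlM
  have h1 := L.order_weierstrassP l hl
  have h2 : 0 ≤ meromorphicOrderAt M.weierstrassP l :=
    (M.analyticOnNhd_weierstrassP l hlM).meromorphicOrderAt_nonneg
  have h3 : L.weierstrassP =ᶠ[𝓝[≠] l] M.weierstrassP := by
    filter_upwards [meromorphicOrderAt_eq_top_iff.1 (htop l)] with z hz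
    simpa [sub_eq_zero] using hz
  rw [← meromorphicOrderAt_congr h3, h1] at h2
  revert h2
  decide

lemma lattice_eq_of_G_eq (L M : PeriodPair) (h : ∀ k, 3 ≤ k → L.G k = M.G k) :
    L.lattice = M.lattice :=
  le_antisymm (lattice_le_of_G_eq L M h) (lattice_le_of_G_eq M L fun k hk => (h k hk).symm)

/-- The period pair `(βτ, β)`. -/
def pairOf (τ : ℍ) (β : ℂ) (hβ : β ≠ 0) : PeriodPair where
  ω₁ := β * τ
  ω₂ := β
  indep := by
    rw [LinearIndependent.pair_iff]
    intro s t hst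
    have h : β * ((s : ℂ) * τ + t) = 0 := by
      simp only [Complex.real_smul] at hst
      linear_combination hst
    have h2 : (s : ℂ) * τ + t = 0 := by simpa [hβ] using h
    have him := congrArg Complex.im h2
    have hre := congrArg Complex.re h2
    have hs : s = 0 := by
      have : s = 0 ∨ τ.im = 0 := by simpa using him
      exact this.resolve_right τ.im_pos.ne'
    subst hs
    simpa using hre

lemma tsum_eq_E {k : ℕ} (hk : 3 ≤ k) (τ : ℍ) :
    ∑' p : ℤ × ℤ, (((p.1 : ℂ) * τ + p.2) ^ k)⁻¹ = 2 * riemannZeta k * ModularForm.E hk τ := by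
  have h := tsum_eisSummand_eq_riemannZeta_mul_eisensteinSeries hk τ
  have h2 : ModularForm.E hk τ =
      (1 / 2 : ℂ) * eisensteinSeries (N := 1) 0 k τ := rfl
  rw [h2]
  have h3 : ∑' p : ℤ × ℤ, (((p.1 : ℂ) * τ + p.2) ^ k)⁻¹ =
      ∑' v : Fin 2 → ℤ, EisensteinSeries.eisSummand k v τ := by
    rw [← (finTwoArrowEquiv ℤ).symm.tsum_eq]
    refine tsum_congr fun p => ?_
    simp [EisensteinSeries.eisSummand]
  rw [h3, h]
  ring

lemma G_pairOf {k : ℕ} (hk : 3 ≤ k) (τ : ℍ) (β : ℂ) (hβ : β ≠ 0) :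
    (pairOf τ β hβ).G k = (β ^ k)⁻¹ * (2 * riemannZeta k * ModularForm.E hk τ) := by
  rw [← tsum_eq_E hk, ← tsum_mul_left, PeriodPair.G,
    ← (pairOf τ β hβ).latticeEquivProd.symm.toEquiv.tsum_eq]
  refine tsum_congr fun p => ?_
  have := (pairOf τ β hβ).latticeEquiv_symm_apply p
  simp only [LinearEquiv.coe_toEquiv]
  rw [this, ← mul_inv, ← mul_pow]
  simp only [pairOf]
  congr 2
  ring

lemma tsum_sub_eq {k : ℕ} (hk : 3 ≤ k) (τ : ℍ) :
    ∑' p : {p : ℤ × ℤ // p ≠ 0}, (((p.1.1 : ℂ) * τ + p.1.2)⁻¹) ^ k =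
     2 * riemannZeta k * ModularForm.E hk τ := by
  rw [← tsum_eq_E hk]
  simp_rw [inv_pow]
  exact tsum_subtype_eq_of_support_subset (f := fun p : ℤ × ℤ => (((p.1 : ℂ) * τ + p.2) ^ k)⁻¹)
    (s := {p | p ≠ 0}) (by
      intro p hp hp0
      subst hp0
      simp [show k ≠ 0 by omega] at hp)

lemma zeta_six : riemannZeta 6 = (Real.pi : ℂ) ^ 6 / 945 := by
  have h := riemannZeta_two_mul_nat (k := 3) (by norm_num)
  rw [show bernoulli (2 * 3) = 1 / 42 by decide +kernel] at h
  norm_num [Nat.factorial] at h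
  rw [h]; ring

lemma exists_gamma (τ₁ τ₂ : ℍ) (β : ℂ) (hβ : β ≠ 0)
    (h : (pairOf τ₁ β hβ).lattice = (pairOf τ₂ 1 one_ne_zero).lattice) :
    ∃ γ : SL(2, ℤ), τ₂ = γ • τ₁ := by
  have m1 : (τ₂ : ℂ) ∈ (pairOf τ₁ β hβ).lattice := by
    rw [h, PeriodPair.mem_lattice]; exact ⟨1, 0, by simp [pairOf]⟩
  have m2 : (1 : ℂ) ∈ (pairOf τ₁ β hβ).lattice := by
    rw [h, PeriodPair.mem_lattice]; exact ⟨0, 1, by simp [pairOf]⟩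
  have m3 : β * τ₁ ∈ (pairOf τ₂ 1 one_ne_zero).lattice := by
    rw [← h, PeriodPair.mem_lattice]; exact ⟨1, 0, by simp [pairOf]⟩
  have m4 : β ∈ (pairOf τ₂ 1 one_ne_zero).lattice := by
    rw [← h, PeriodPair.mem_lattice]; exact ⟨0, 1, by simp [pairOf]⟩
  rw [PeriodPair.mem_lattice] at m1 m2 m3 m4
  obtain ⟨a, b, e1⟩ := m1
  obtain ⟨c, d, e2⟩ := m2
  obtain ⟨aq, bq, e3⟩ := m3
  obtain ⟨cq, dq, e4⟩ := m4
  simp only [pairOf] at e1 e2 e3 e4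
  have indep : ∀ s t : ℤ, (s : ℂ) * τ₂ + t = 0 → s = 0 ∧ t = 0 := by
    intro s t hst
    have him := congrArg Complex.im hst
    have hre := congrArg Complex.re hst
    have hs : s = 0 := by
      have : s = 0 ∨ τ₂.im = 0 := by simpa using him
      exact this.resolve_right τ₂.im_pos.ne'
    subst hs
    exact ⟨rfl, by simpa using hre⟩
  obtain ⟨r1, r2⟩ := indep (a * aq + b * cq - 1) (a * bq + b * dq) (by
    push_cast; linear_combination e1 + a * e3 + b * e4)
  obtain ⟨r3, r4⟩ := indep (c * aq + d * cq) (c * bq + d * dq - 1) (by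
    push_cast; linear_combination e2 + c * e3 + d * e4)
  have hdet : (a * d - b * c) * (aq * dq - bq * cq) = 1 := by
    linear_combination (c * bq + d * dq) * r1 + r4 - (a * bq + b * dq) * r3
  have hcd : (c : ℂ) * τ₁ + d ≠ 0 := by
    intro h0
    have : (1 : ℂ) = 0 := by rw [← e2]; linear_combination β * h0
    exact one_ne_zero this
  have key : (τ₂ : ℂ) * (c * τ₁ + d) = a * τ₁ + b := by
    have : β * ((τ₂ : ℂ) * (c * τ₁ + d)) = β * (a * τ₁ + b) := by
      linear_combination τ₂ * e2 - e1
    exact mul_left_cancel₀ hβ this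
  have hd1 : a * d - b * c = 1 := by
    rcases Int.eq_one_or_neg_one_of_mul_eq_one hdet with h1 | h1
    · exact h1
    · exfalso
      have him := congrArg Complex.im (congrArg (· * (starRingEnd ℂ) (c * τ₁ + d)) key)
      simp at him
      have h1' : (a : ℝ) * d - b * c = -1 := by exact_mod_cast h1
      have p1 := τ₁.im_pos
      have p2 := τ₂.im_pos
      have hre0 : 0 ≤ τ₂.im * ((c * τ₁.re + d) ^ 2 + (c * τ₁.im) ^ 2) := by positivity
      have : τ₂.im * ((c * τ₁.re + d) ^ 2 + (c * τ₁.im) ^ 2) = (a * d - b * c) * τ₁.im := by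
        linear_combination him
      rw [h1'] at this
      linarith
  let γ : SL(2, ℤ) := ⟨!![a, b; c, d], by rw [Matrix.det_fin_two_of]; exact hd1⟩
  refine ⟨γ, ?_⟩
  apply UpperHalfPlane.ext
  rw [UpperHalfPlane.coe_specialLinearGroup_apply]
  simp [γ]
  rw [eq_div_iff hcd]
  exact key

open ModularForm EisensteinSeries ModularFormClass

lemma form_smul {k : ℤ} (f : ModularForm 𝒮ℒ k) (γ : SL(2, ℤ)) (τ : ℍ) :
    f (γ • τ) = (denom γ τ) ^ k * f τ :=
  SlashInvariantForm.slash_action_eqn' (Γ := 𝒮ℒ) f (γ := (γ : GL (Fin 2) ℝ)) ⟨γ, rfl⟩ τ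

lemma form_S {k : ℤ} (f : ModularForm 𝒮ℒ k) (τ : ℍ) :
    f (ModularGroup.S • τ) = (τ : ℂ) ^ k * f τ := by
  rw [form_smul, ModularGroup.denom_S]

lemma form_T {k : ℤ} (f : ModularForm 𝒮ℒ k) (τ : ℍ) :
    f (ModularGroup.T • τ) = f τ := by
  rw [form_smul, ModularGroup.denom_apply]; simp [ModularGroup.T]

lemma g2fun_eq (τ : ℍ) : g2fun τ = 4 / 3 * Real.pi ^ 4 * E₄ τ := by
  have := tsum_sub_eq (k := 4) (by norm_num) τ
  unfold g2fun latticePt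
  rw [this]
  have h := riemannZeta_four
  push_cast
  rw [h]
  ring

lemma g3fun_eq (τ : ℍ) : g3fun τ = 8 / 27 * Real.pi ^ 6 * E₆ τ := by
  have := tsum_sub_eq (k := 6) (by norm_num) τ
  unfold g3fun latticePt
  rw [this]
  have h := zeta_six
  push_cast
  rw [h]
  ring

lemma jfun_eq (τ : ℍ) : jfun τ = E₄ τ ^ 3 / ModularForm.discriminant τ := by
  have hΔ := ModularForm.discriminant_eq_E₄_cube_sub_E₆_sq τ
  have h0 := ModularForm.discriminant_ne_zero τ
  have hpi : (Real.pi : ℂ) ≠ 0 := by exact_mod_cast Real.pi_ne_zero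
  have hd : deltaFun τ = 4096 * Real.pi ^ 12 * ModularForm.discriminant τ := by
    rw [deltaFun, g2fun_eq, g3fun_eq, hΔ]; ring
  rw [jfun, hd, g2fun_eq]
  field_simp
  ring

lemma E4_smul (γ : SL(2, ℤ)) (τ : ℍ) : E₄ (γ • τ) = (denom γ τ) ^ 4 * E₄ τ := by
  have := form_smul E₄ γ τ
  exact_mod_cast this

lemma E6_smul (γ : SL(2, ℤ)) (τ : ℍ) : E₆ (γ • τ) = (denom γ τ) ^ 6 * E₆ τ := by
  have := form_smul E₆ γ τ
  exact_mod_cast this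

lemma jfun_smul (γ : SL(2, ℤ)) (τ : ℍ) : jfun (γ • τ) = jfun τ := by
  have h0 := ModularForm.discriminant_ne_zero τ
  have hd : denom γ τ ≠ 0 := denom_ne_zero _ _
  have hΔ : ModularForm.discriminant (γ • τ) = (denom γ τ) ^ 12 * ModularForm.discriminant τ := by
    rw [ModularForm.discriminant_eq_E₄_cube_sub_E₆_sq, ModularForm.discriminant_eq_E₄_cube_sub_E₆_sq,
      E4_smul, E6_smul]
    ring
  rw [jfun_eq, jfun_eq, hΔ, E4_smul, mul_pow, ← pow_mul]
  exact mul_div_mul_left _ _ (pow_ne_zero _ hd)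

lemma jfun_zeta4 : jfun zeta4H = 1728 := by
  have h0 := ModularForm.discriminant_ne_zero zeta4H
  have hΔ := ModularForm.discriminant_eq_E₄_cube_sub_E₆_sq zeta4H
  have hS : ModularGroup.S • zeta4H = zeta4H := by
    rw [UpperHalfPlane.modular_S_smul]
    ext1
    simp [zeta4H]
  have h6 := form_S E₆ zeta4H
  rw [hS] at h6
  have hI : ((zeta4H : ℂ)) ^ (6 : ℤ) = -1 := by
    have : ((zeta4H : ℂ)) ^ 6 = -1 := by
      change Complex.I ^ 6 = -1
      rw [show 6 = 2 * 3 from rfl, pow_mul, Complex.I_sq]; norm_num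
    exact_mod_cast this
  have hE : E₆ zeta4H = 0 := by
    have : ((6 : ℕ) : ℤ) = 6 := rfl
    rw [hI] at h6
    linear_combination h6 / 2
  rw [hE] at hΔ
  have h4 : E₄ zeta4H ^ 3 = 1728 * ModularForm.discriminant zeta4H := by
    rw [hΔ]; ring
  rw [jfun_eq, h4]
  field_simp

lemma jfun_zeta3 : jfun zeta3H = 0 := by
  have hprim := Complex.isPrimitiveRoot_exp 3 (by norm_num)
  have hz : (zeta3H : ℂ) = Complex.exp (2 * Real.pi * Complex.I / 3) := rfl
  push_cast at hprim
  rw [← hz] at hprim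
  have h3 : (zeta3H : ℂ) ^ 3 = 1 := hprim.pow_eq_one
  have h1 : (zeta3H : ℂ) ≠ 1 := hprim.ne_one (by norm_num)
  have hz0 : (zeta3H : ℂ) ≠ 0 := UpperHalfPlane.ne_zero _
  have hq : (zeta3H : ℂ) ^ 2 + zeta3H + 1 = 0 := by
    have : ((zeta3H : ℂ) - 1) * ((zeta3H : ℂ) ^ 2 + zeta3H + 1) = 0 := by linear_combination h3
    exact (mul_eq_zero.mp this).resolve_left (sub_ne_zero.mpr h1)
  have hST : ModularGroup.S • zeta3H = ModularGroup.T • zeta3H := by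
    rw [UpperHalfPlane.modular_S_smul, UpperHalfPlane.modular_T_smul]
    ext1
    rw [UpperHalfPlane.coe_vadd]
    change (-(zeta3H : ℂ))⁻¹ = _
    push_cast
    apply inv_eq_of_mul_eq_one_right
    linear_combination -hq
  have h4 := form_S E₄ zeta3H
  rw [hST, form_T] at h4
  have hp : ((zeta3H : ℂ)) ^ (4 : ℤ) = zeta3H := by
    have : ((zeta3H : ℂ)) ^ 4 = zeta3H := by linear_combination (zeta3H : ℂ) * h3
    exact_mod_cast this
  rw [hp] at h4
  have hE : E₄ zeta3H = 0 := by
    have : ((zeta3H : ℂ) - 1) * E₄ zeta3H = 0 := by linear_combination -h4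
    exact (mul_eq_zero.mp this).resolve_left (sub_ne_zero.mpr h1)
  rw [jfun_eq, hE]
  simp

lemma E4_coeff : (qExpansion 1 E₄).coeff 0 = 1 := E_qExpansion_coeff_zero _ ⟨2, rfl⟩

lemma E6_coeff : (qExpansion 1 E₆).coeff 0 = 1 := E_qExpansion_coeff_zero _ ⟨3, rfl⟩

lemma discr_smul_form (α : ℂ) (τ₁ τ₂ : ℍ)
    (h4 : E₄ τ₂ = α ^ 4 * E₄ τ₁) (h6 : E₆ τ₂ = α ^ 6 * E₆ τ₁) :
    ModularForm.discriminant τ₂ = α ^ 12 * ModularForm.discriminant τ₁ := by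
  rw [ModularForm.discriminant_eq_E₄_cube_sub_E₆_sq, ModularForm.discriminant_eq_E₄_cube_sub_E₆_sq,
    h4, h6]
  ring

lemma form_scale (α : ℂ) (hα : α ≠ 0) (τ₁ τ₂ : ℍ)
    (h4 : E₄ τ₂ = α ^ 4 * E₄ τ₁) (h6 : E₆ τ₂ = α ^ 6 * E₆ τ₁) (n : ℕ) :
    ∀ k : ℤ, k < n → ∀ f : ModularForm 𝒮ℒ k, f τ₂ = α ^ k * f τ₁ := by
  induction n with
  | zero =>
    intro k hk f
    have := ModularFormClass.levelOne_neg_weight_eq_zero (by exact_mod_cast hk) f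
    simp [this]
  | succ n ih =>
    intro k hk f
    push_cast at hk
    rcases lt_or_ge k 0 with h0 | h0
    · have := ModularFormClass.levelOne_neg_weight_eq_zero h0 f
      simp [this]
    rcases Int.even_or_odd k with he | ho
    swap
    · rw [ModularForm.levelOne_odd_weight_eq_zero ho f]; simp
    by_cases hk0 : k = 0
    · subst hk0
      obtain ⟨c, hc⟩ := ModularFormClass.levelOne_weight_zero_const f
      simp [hc]
    by_cases hk2 : k = 2
    · subst hk2
      rw [rank_zero_iff_forall_zero.mp ModularForm.levelOne_weight_two_rank_zero f]
      simp
    obtain ⟨a, b, hab⟩ : ∃ a b : ℕ, (a : ℤ) * 4 + (b : ℤ) * 6 = k := by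
      obtain ⟨m, rfl⟩ := he
      rcases Int.even_or_odd m with ⟨r, rfl⟩ | ⟨r, rfl⟩
      · exact ⟨r.toNat, 0, by omega⟩
      · exact ⟨(r - 1).toNat, 1, by omega⟩
    let g : ModularForm 𝒮ℒ k := ModularForm.mcast hab ((E₄.pow a).mul (E₆.pow b))
    have hg : ∀ z, g z = E₄ z ^ a * E₆ z ^ b := by
      intro z
      simp [g, ModularForm.coe_mcast, ModularForm.coe_pow]
    have hg0 : (qExpansion 1 g).coeff 0 = 1 := by
      simp only [g, ModularForm.coe_mcast,
        ModularForm.qExpansion_mul one_pos one_mem_strictPeriods_SL,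
        ModularForm.qExpansion_pow one_pos one_mem_strictPeriods_SL]
      have e4 := E4_coeff
      have e6 := E6_coeff
      rw [PowerSeries.coeff_zero_eq_constantCoeff] at e4 e6 ⊢
      rw [map_mul, map_pow, map_pow, e4, e6]
      simp
    have hgs : g τ₂ = α ^ k * g τ₁ := by
      rw [hg, hg, h4, h6, ← hab, zpow_add₀ hα, mul_comm (a : ℤ), mul_comm (b : ℤ), _root_.zpow_mul,
        _root_.zpow_mul, mul_pow, mul_pow]
      simp only [zpow_natCast]
      norm_cast
      ring
    have hcusp := (isCuspForm_iff_coeffZero_eq_zero _).mp (sub_smul_isCuspForm f g hg0)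
    set c := (qExpansion 1 f).coeff 0
    let F := ModularForm.toCuspForm (f - c • g) hcusp
    have hF : ∀ z, F z = f z - c * g z := fun z => rfl
    have hD := ih (k - 12) (by omega) (CuspForm.discriminantEquiv F)
    have e1 := ModularForm.discriminant_mul_discriminantEquiv_apply F τ₁
    have e2 := ModularForm.discriminant_mul_discriminantEquiv_apply F τ₂
    have hFs : F τ₂ = α ^ k * F τ₁ := by
      rw [← e1, ← e2, hD, discr_smul_form α τ₁ τ₂ h4 h6, zpow_sub₀ hα]
      have : α ^ (12 : ℤ) = α ^ 12 := by norm_cast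
      rw [this]
      field_simp
    rw [hF, hF, hgs] at hFs
    linear_combination hFs

lemma exists_alpha (τ₁ τ₂ : ℍ) (h : jfun τ₁ = jfun τ₂) :
    ∃ α : ℂ, α ≠ 0 ∧ E₄ τ₂ = α ^ 4 * E₄ τ₁ ∧ E₆ τ₂ = α ^ 6 * E₆ τ₁ := by
  have d1 := ModularForm.discriminant_ne_zero τ₁
  have d2 := ModularForm.discriminant_ne_zero τ₂
  rw [jfun_eq, jfun_eq, div_eq_div_iff d1 d2] at h
  rw [ModularForm.discriminant_eq_E₄_cube_sub_E₆_sq] at d1 d2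
  rw [ModularForm.discriminant_eq_E₄_cube_sub_E₆_sq, ModularForm.discriminant_eq_E₄_cube_sub_E₆_sq]
    at h
  generalize E₄ τ₁ = a at *
  generalize E₄ τ₂ = c at *
  generalize E₆ τ₁ = b at *
  generalize E₆ τ₂ = d at *
  have hx : a ^ 3 * d ^ 2 = c ^ 3 * b ^ 2 := by linear_combination (-1728) * h
  have d1' : a ^ 3 - b ^ 2 ≠ 0 := fun h => d1 (by rw [h]; simp)
  have d2' : c ^ 3 - d ^ 2 ≠ 0 := fun h => d2 (by rw [h]; simp)
  clear d1 d2 h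
  by_cases ha : a = 0
  · subst ha
    have hb : b ≠ 0 := by rintro rfl; simp at d1'
    have hc : c = 0 := by simpa [hb] using hx.symm
    subst hc
    have hd : d ≠ 0 := by rintro rfl; simp at d2'
    obtain ⟨α, hα⟩ := IsAlgClosed.exists_pow_nat_eq (d / b) (n := 6) (by norm_num)
    refine ⟨α, ?_, by simp, ?_⟩
    · rintro rfl
      exact div_ne_zero hd hb (by rw [← hα]; simp)
    · rw [hα]; field_simp
  by_cases hb : b = 0
  · subst hb
    have hd : d = 0 := by simpa [ha] using hx
    subst hd
    have hc : c ≠ 0 := by rintro rfl; simp at d2'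
    obtain ⟨α, hα⟩ := IsAlgClosed.exists_pow_nat_eq (c / a) (n := 4) (by norm_num)
    refine ⟨α, ?_, ?_, by simp⟩
    · rintro rfl
      exact div_ne_zero hc ha (by rw [← hα]; simp)
    · rw [hα]; field_simp
  have hc : c ≠ 0 := by
    rintro rfl
    have hd : d = 0 := by simpa [ha] using hx
    subst hd
    simp at d2'
  have hd : d ≠ 0 := by
    rintro rfl
    have : c = 0 := by simpa [hb] using hx.symm
    exact hc this
  obtain ⟨α, hα⟩ := IsAlgClosed.exists_pow_nat_eq ((d / b) / (c / a)) (n := 2) (by norm_num)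
  refine ⟨α, ?_, ?_, ?_⟩
  · rintro rfl
    exact div_ne_zero (div_ne_zero hd hb) (div_ne_zero hc ha) (by rw [← hα]; simp)
  · rw [show α ^ 4 = (α ^ 2) ^ 2 by ring, hα]
    field_simp
    linear_combination -hx
  · rw [show α ^ 6 = (α ^ 2) ^ 3 by ring, hα]
    field_simp
    linear_combination -hx

lemma gamma_of_jfun_eq (τ₁ τ₂ : ℍ) (h : jfun τ₁ = jfun τ₂) : ∃ γ : SL(2, ℤ), τ₂ = γ • τ₁ := by
  obtain ⟨α, hα, h4, h6⟩ := exists_alpha τ₁ τ₂ h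
  refine exists_gamma τ₁ τ₂ α⁻¹ (inv_ne_zero hα) (lattice_eq_of_G_eq _ _ fun k hk => ?_)
  rw [G_pairOf hk, G_pairOf hk, form_scale α hα τ₁ τ₂ h4 h6 (k + 1) k (by push_cast; omega)]
  simp only [inv_pow, inv_inv, one_pow, inv_one, one_mul, zpow_natCast]
  ring

open Filter in
lemma form_tendsto {k : ℤ} (f : ModularForm 𝒮ℒ k) :
    Tendsto f atImInfty (nhds ((qExpansion 1 f).coeff 0)) := by
  have hanal := ModularFormClass.analyticAt_cuspFunction_zero f one_pos one_mem_strictPeriods_SL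
  have hper := SlashInvariantFormClass.periodic_comp_ofComplex f one_mem_strictPeriods_SL
  rw [qExpansion_coeff_zero one_pos hanal hper, ← cuspFunction_apply_zero one_pos hanal hper]
  exact (hanal.continuousAt.tendsto.comp (qParam_tendsto_atImInfty one_pos)).congr
    (fun τ ↦ SlashInvariantFormClass.eq_cuspFunction f τ one_mem_strictPeriods_SL one_ne_zero)

lemma exists_zero_form (f : ModularForm 𝒮ℒ 12) (h1 : (qExpansion 1 f).coeff 0 = 1) :
    ∃ τ, f τ = 0 := by
  by_contra! hne
  have hsl : ∀ γ : SL(2, ℤ), ((1 : ℍ → ℂ) / ⇑f) ∣[(0 - 12 : ℤ)] γ = (1 : ℍ → ℂ) / ⇑f := by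
    intro γ
    rw [div_slash_SL2, show (⇑f ∣[(12 : ℤ)] γ) = ⇑f from f.slash_action_eq' _ ⟨γ, rfl⟩]
    congr 1
    exact ModularForm.is_invariant_one γ
  let g : ModularForm 𝒮ℒ (0 - 12) :=
    { toFun := (1 : ℍ → ℂ) / ⇑f
      slash_action_eq' := fun _ ⟨γ, hγ⟩ ↦ hγ ▸ hsl γ
      holo' := (1 : ModularForm 𝒮ℒ 0).holo'.div f.holo' hne
      bdd_at_cusps' := by
        intro c hc
        rw [Subgroup.IsArithmetic.isCusp_iff_isCusp_SL2Z] at hc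
        rw [OnePoint.isBoundedAt_iff_forall_SL2Z hc]
        intro γ _
        rw [hsl γ, IsBoundedAtImInfty, Filter.BoundedAtFilter]
        have ht := (form_tendsto f).inv₀ (by rw [h1]; exact one_ne_zero)
        have := ht.isBigO_one ℝ
        refine this.congr_left fun z => ?_
        simp }
  have hz := ModularFormClass.levelOne_neg_weight_eq_zero (by norm_num) g
  have := congr_fun hz I
  have h2 : g I = 1 / f I := rfl
  rw [h2] at this
  exact one_div_ne_zero (hne I) this

lemma jfun_surj (w : ℂ) : ∃ τ : ℍ, jfun τ = w := by
  let A : ModularForm 𝒮ℒ 12 := ModularForm.mcast (by decide) (E₄.pow 3)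
  let B : ModularForm 𝒮ℒ 12 := ModularForm.mcast (by decide) (E₆.pow 2)
  have hA : ∀ z, A z = E₄ z ^ 3 := fun z => by
    simp only [A, ModularForm.coe_mcast, ModularForm.coe_pow, Pi.pow_apply]
  have hB : ∀ z, B z = E₆ z ^ 2 := fun z => by
    simp only [B, ModularForm.coe_mcast, ModularForm.coe_pow, Pi.pow_apply]
  have hA0 : (qExpansion 1 A).coeff 0 = 1 := by
    simp only [A, ModularForm.coe_mcast,
      ModularForm.qExpansion_pow one_pos one_mem_strictPeriods_SL]
    have e4 := E4_coeff
    rw [PowerSeries.coeff_zero_eq_constantCoeff] at e4 ⊢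
    rw [map_pow, e4, one_pow]
  have hB0 : (qExpansion 1 B).coeff 0 = 1 := by
    simp only [B, ModularForm.coe_mcast,
      ModularForm.qExpansion_pow one_pos one_mem_strictPeriods_SL]
    have e4 := E6_coeff
    rw [PowerSeries.coeff_zero_eq_constantCoeff] at e4 ⊢
    rw [map_pow, e4, one_pow]
  obtain ⟨τ, hτ⟩ := exists_zero_form (A - (w / 1728) • (A - B)) (by
    rw [FunLike.coe_sub, ModularForm.qExpansion_sub one_pos one_mem_strictPeriods_SL,
      FunLike.coe_smul, ModularForm.qExpansion_smul one_pos one_mem_strictPeriods_SL,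
      FunLike.coe_sub, ModularForm.qExpansion_sub one_pos one_mem_strictPeriods_SL,
      map_sub, PowerSeries.coeff_smul, map_sub, hA0, hB0]
    simp)
  refine ⟨τ, ?_⟩
  have h0 := ModularForm.discriminant_ne_zero τ
  have hτ' : A τ - (w / 1728) * (A τ - B τ) = 0 := hτ
  rw [jfun_eq, div_eq_iff h0, ModularForm.discriminant_eq_E₄_cube_sub_E₆_sq]
  rw [hA, hB] at hτ'
  linear_combination hτ'

/-- `j` induces a bijection `SL₂(ℤ)∖ℍ → ℂ`, with `j(ζ₃) = 0` and
`j(ζ₄) = 1728`. -/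
theorem jfun_bijection :
    (∀ w : ℂ, ∃ τ : ℍ, jfun τ = w) ∧
    (∀ τ₁ τ₂ : ℍ, jfun τ₁ = jfun τ₂ ↔ ∃ γ : SL2Z, τ₂ = γ • τ₁) ∧
    jfun zeta3H = 0 ∧ jfun zeta4H = 1728 := by
  refine ⟨jfun_surj, fun τ₁ τ₂ => ⟨gamma_of_jfun_eq τ₁ τ₂, ?_⟩, jfun_zeta3, jfun_zeta4⟩
  rintro ⟨γ, rfl⟩
  exact (jfun_smul γ τ₁).symm

end
end
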